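/- arXiv:1607.06136 — 4 statements merged into one kernel-verified Lean document; each statement's English description precedes it below -/
import Mathlib

section
/- Let K be a finite simplicial complex that is the union of nonempty connected subcomplexes K₁, …, K_n such that |K_i| ∩ |K_j| ∩ |K_k| = ∅ for all pairwise distinct i, j, k, and let G be the simple graph on vertices {1, …, n} with an edge {i, j} whenever |K_i| ∩ |K_j| ≠ ∅. Then for any field F, the dimension of H₁(|K|; F) is at least the dimension of H₁(G; F). -/
open CategoryTheory

/-- Singular homology of a topological space with coefficients in a field `F`, defined as
the homology of the alternating-face-map complex of the levelwise free `F`-module on the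
singular simplicial set of the space. -/
noncomputable def singularHomologyFunctor (F : Type) [Field F] (n : ℕ) :
    TopCat.{0} ⥤ ModuleCat F :=
  TopCat.toSSet ⋙ ((SimplicialObject.whiskering _ _).obj (ModuleCat.free F)) ⋙
    AlgebraicTopology.alternatingFaceMapComplex _ ⋙
      HomologicalComplex.homologyFunctor _ _ n

/-- The standard geometric realization of a simple graph `G` on `Fin n`, drawn in `ℝⁿ`:
vertex `i` is placed at the basis vector `eᵢ`, and each edge `{i,j}` is realized as the
straight segment `[eᵢ, eⱼ]`. -/
def graphRealization {n : ℕ} (G : SimpleGraph (Fin n)) : Set (Fin n → ℝ) :=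
  Set.range (fun i : Fin n => (Pi.single i 1 : Fin n → ℝ)) ∪
    ⋃ (i : Fin n) (j : Fin n) (_ : G.Adj i j),
      segment ℝ (Pi.single i 1) (Pi.single j 1)

/-- Homotopic maps induce the same map on singular homology. -/
theorem singularHomologyFunctor_map_eq_of_homotopy (F : Type) [Field F] (n : ℕ)
    {X Y : TopCat.{0}} {f g : X ⟶ Y} (H : TopCat.Homotopy f g) :
    (singularHomologyFunctor F n).map f = (singularHomologyFunctor F n).map g :=
  (H.toSSet.toSimplicialObjectHomotopy.whiskerRight (ModuleCat.free F)).map_homology_eq n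

/-- If `X` is a homotopy retract of `Y`, the homology of `X` has at most the dimension of the
homology of `Y`. -/
theorem rank_singularHomology_le_of_homotopy_retract (F : Type) [Field F] (n : ℕ)
    {X Y : Type} [TopologicalSpace X] [TopologicalSpace Y] (g : C(X, Y)) (f : C(Y, X))
    (H : (f.comp g).Homotopy (ContinuousMap.id X)) :
    Module.rank F ((singularHomologyFunctor F n).obj (TopCat.of X)) ≤
      Module.rank F ((singularHomologyFunctor F n).obj (TopCat.of Y)) := by
  have H' : TopCat.Homotopy (TopCat.ofHom g ≫ TopCat.ofHom f) (𝟙 (TopCat.of X)) := H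
  have h := singularHomologyFunctor_map_eq_of_homotopy F n H'
  rw [CategoryTheory.Functor.map_comp, CategoryTheory.Functor.map_id] at h
  refine LinearMap.rank_le_of_injective
    ((singularHomologyFunctor F n).map (TopCat.ofHom g)).hom ?_
  refine Function.LeftInverse.injective
    (g := ((singularHomologyFunctor F n).map (TopCat.ofHom f)).hom) fun x => ?_
  exact congrArg (fun φ => φ.hom x) h

/-- A connected finite union of closed path-connected sets is path-connected. -/
theorem IsConnected.isPathConnected_iUnion {X ι : Type*} [TopologicalSpace X] [Finite ι]
    {S : ι → Set X} (hc : ∀ i, IsClosed (S i)) (hp : ∀ i, IsPathConnected (S i))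
    (h : _root_.IsConnected (⋃ i, S i)) : IsPathConnected (⋃ i, S i) := by
  set U := ⋃ i, S i with hU
  obtain ⟨x, hx⟩ := h.nonempty
  refine ⟨x, hx, fun {y} hy => ?_⟩
  have key : ∀ i, ∀ z ∈ S i, ∀ w ∈ S i, JoinedIn U z w := fun i z hz w hw =>
    ((hp i).joinedIn z hz w hw).mono (Set.subset_iUnion S i)
  by_contra hxy
  let P : Set X := ⋃ i : {i // ∀ z ∈ S i, JoinedIn U x z}, S i
  let Q : Set X := ⋃ i : {i // ¬ ∀ z ∈ S i, JoinedIn U x z}, S i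
  have hPQ : U ⊆ P ∪ Q := by
    intro z hz
    obtain ⟨i, hi⟩ := Set.mem_iUnion.1 hz
    by_cases hh : ∀ z ∈ S i, JoinedIn U x z
    · exact Or.inl (Set.mem_iUnion.2 ⟨⟨i, hh⟩, hi⟩)
    · exact Or.inr (Set.mem_iUnion.2 ⟨⟨i, hh⟩, hi⟩)
  have hxP : x ∈ P := by
    obtain ⟨i, hi⟩ := Set.mem_iUnion.1 hx
    exact Set.mem_iUnion.2 ⟨⟨i, key i x hi⟩, hi⟩
  have hyQ : y ∈ Q := by
    obtain ⟨i, hi⟩ := Set.mem_iUnion.1 hy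
    exact Set.mem_iUnion.2 ⟨⟨i, fun hh => hxy (hh y hi)⟩, hi⟩
  obtain ⟨z, -, hzP, hzQ⟩ := isPreconnected_closed_iff.1 h.isPreconnected P Q
    (isClosed_iUnion_of_finite fun i => hc i) (isClosed_iUnion_of_finite fun i => hc i) hPQ
    ⟨x, hx, hxP⟩ ⟨y, hy, hyQ⟩
  obtain ⟨⟨i, hi⟩, hzi⟩ := Set.mem_iUnion.1 hzP
  obtain ⟨⟨j, hj⟩, hzj⟩ := Set.mem_iUnion.1 hzQ
  exact hj fun w hw => (hi z hzi).trans (key j z hzj w hw)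

namespace Geometry.SimplicialComplex

variable {E : Type*} [AddCommGroup E] [Module ℝ E] [TopologicalSpace E]
  [IsTopologicalAddGroup E] [ContinuousSMul ℝ E] {K : SimplicialComplex ℝ E}

/-- The space of a finite simplicial complex is compact. -/
theorem isCompact_space (hK : K.faces.Finite) : IsCompact K.space :=
  hK.isCompact_biUnion fun s _ => s.finite_toSet.isCompact_convexHull ℝ

/-- The space of a finite connected simplicial complex is path-connected. -/
theorem isPathConnected_space [T2Space E] (hK : K.faces.Finite)
    (h : _root_.IsConnected K.space) : IsPathConnected K.space := by
  have := hK.to_subtype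
  have e : K.space = ⋃ s : K.faces, convexHull ℝ (s.1 : Set E) := by
    rw [space, Set.biUnion_eq_iUnion]
  rw [e] at h ⊢
  exact h.isPathConnected_iUnion (fun s => s.1.finite_toSet.isClosed_convexHull ℝ)
    fun s => (convex_convexHull ℝ _).isPathConnected
      (convexHull_nonempty_iff.2 (nonempty_of_mem_faces s.2))

end Geometry.SimplicialComplex

section Retraction

variable {n : ℕ}

/-- Division of a vector by the sum of its coordinates. -/
noncomputable def divSum (y : Fin n → ℝ) : Fin n → ℝ := fun l => y l / ∑ k, y k

/-- The third largest coordinate of a vector, counted with multiplicity and truncated at `0`. -/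
noncomputable def thirdMax (x : Fin n → ℝ) : NNReal :=
  Finset.univ.sup fun p : Fin n × Fin n × Fin n =>
    if p.1 ≠ p.2.1 ∧ p.2.1 ≠ p.2.2 ∧ p.1 ≠ p.2.2 then
      (min (x p.1) (min (x p.2.1) (x p.2.2))).toNNReal else 0

/-- The part of each coordinate exceeding the third largest one. -/
noncomputable def excess (x : Fin n → ℝ) : Fin n → ℝ := fun l => max 0 (x l - thirdMax x)

theorem continuous_thirdMax : Continuous (thirdMax : (Fin n → ℝ) → NNReal) := by
  unfold thirdMax
  refine Continuous.finset_sup_apply fun p _ => ?_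
  split_ifs <;> fun_prop

theorem continuous_excess : Continuous (excess : (Fin n → ℝ) → Fin n → ℝ) := by
  have := continuous_thirdMax (n := n)
  unfold excess
  fun_prop

theorem min_le_thirdMax (x : Fin n → ℝ) {i j k : Fin n} (hij : i ≠ j) (hjk : j ≠ k) (hik : i ≠ k) :
    min (x i) (min (x j) (x k)) ≤ thirdMax x := by
  refine (Real.le_coe_toNNReal _).trans (NNReal.coe_le_coe.2 ?_)
  refine le_trans ?_ (Finset.le_sup (Finset.mem_univ (i, j, k)))
  simp [hij, hjk, hik]

theorem thirdMax_le {x : Fin n → ℝ} {c : ℝ} (hc : 0 ≤ c)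
    (h : ∀ i j k, i ≠ j → j ≠ k → i ≠ k → min (x i) (min (x j) (x k)) ≤ c) :
    (thirdMax x : ℝ) ≤ c := by
  lift c to NNReal using hc
  refine NNReal.coe_le_coe.2 (Finset.sup_le fun p _ => ?_)
  split_ifs with hp
  · exact Real.toNNReal_le_iff_le_coe.2 (h _ _ _ hp.1 hp.2.1 hp.2.2)
  · exact zero_le

theorem continuousOn_divSum :
    ContinuousOn (divSum : (Fin n → ℝ) → Fin n → ℝ) {y | ∑ k, y k ≠ 0} := by
  unfold divSum
  refine continuousOn_pi.2 fun l => ContinuousOn.div (by fun_prop) (by fun_prop) fun y hy => hy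

theorem sum_pos_of_nonneg_of_pos {y : Fin n → ℝ} (hy : ∀ l, 0 ≤ y l) {i : Fin n} (hi : 0 < y i) :
    0 < ∑ k, y k :=
  Finset.sum_pos' (fun l _ => hy l) ⟨i, Finset.mem_univ i, hi⟩

/-- The part of the standard simplex where the coordinate `i` is at least `1 / 2` and the other
nonzero coordinates are at neighbours of `i`. -/
def halfStar (G : SimpleGraph (Fin n)) (i : Fin n) : Set (Fin n → ℝ) :=
  {x | x ∈ stdSimplex ℝ (Fin n) ∧ 1 / 2 ≤ x i ∧ ∀ j, j ≠ i → 0 < x j → G.Adj i j}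

variable {G : SimpleGraph (Fin n)}

theorem convex_halfStar (i : Fin n) : Convex ℝ (halfStar G i) := by
  rintro x ⟨hx, hxi, hxG⟩ y ⟨hy, hyi, hyG⟩ a b ha hb hab
  refine ⟨convex_stdSimplex ℝ (Fin n) hx hy ha hb hab, ?_, fun j hj h => ?_⟩
  · simp only [Pi.add_apply, Pi.smul_apply, smul_eq_mul]
    nlinarith
  · simp only [Pi.add_apply, Pi.smul_apply, smul_eq_mul] at h
    by_contra hG
    have h1 : x j ≤ 0 := not_lt.1 fun h => hG (hxG j hj h)
    have h2 : y j ≤ 0 := not_lt.1 fun h => hG (hyG j hj h)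
    nlinarith

theorem divSum_mem_graphRealization {y : Fin n → ℝ} (hy : ∀ l, 0 ≤ y l) {i : Fin n}
    (hi : 0 < y i) (hG : ∀ j, j ≠ i → 0 < y j → G.Adj i j)
    (huniq : ∀ j k, j ≠ i → k ≠ i → 0 < y j → 0 < y k → j = k) :
    divSum y ∈ graphRealization G := by
  have hs := sum_pos_of_nonneg_of_pos hy hi
  by_cases h : ∃ j, j ≠ i ∧ 0 < y j
  · obtain ⟨j, hji, hj⟩ := h
    have h0 : ∀ l, l ≠ i → l ≠ j → y l = 0 := fun l hli hlj =>
      ((hy l).eq_or_lt.resolve_right fun h => hlj (huniq l j hli hji h hj)).symm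
    have hsum : ∑ k, y k = y i + y j :=
      Fintype.sum_eq_add i j hji.symm fun l hl => h0 l hl.1 hl.2
    refine Or.inr (Set.mem_iUnion.2 ⟨i, Set.mem_iUnion.2 ⟨j, Set.mem_iUnion.2 ⟨hG j hji hj, ?_⟩⟩⟩)
    refine ⟨y i / ∑ k, y k, y j / ∑ k, y k, by positivity, by positivity, ?_, ?_⟩
    · rw [← add_div, hsum, div_self (hsum ▸ hs.ne')]
    · ext l
      simp only [divSum, Pi.add_apply, Pi.smul_apply, smul_eq_mul, Pi.single_apply]
      by_cases hli : l = i
      · subst hli; simp [hji.symm]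
      · by_cases hlj : l = j
        · subst hlj; simp [hji]
        · simp [hli, hlj, h0 l hli hlj]
  · push Not at h
    have h0 : ∀ l, l ≠ i → y l = 0 := fun l hl => le_antisymm (h l hl) (hy l)
    refine Or.inl ⟨i, ?_⟩
    have hsum : ∑ k, y k = y i := Fintype.sum_eq_single i h0
    ext l
    by_cases hl : l = i
    · subst hl; simp [divSum, hsum, hi.ne']
    · simp [divSum, hl, h0 l hl]

theorem divSum_mem_halfStar {y : Fin n → ℝ} (hy : ∀ l, 0 ≤ y l) {i : Fin n}
    (hi : 0 < y i) (hmax : ∀ j, y j ≤ y i) (hG : ∀ j, j ≠ i → 0 < y j → G.Adj i j)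
    (huniq : ∀ j k, j ≠ i → k ≠ i → 0 < y j → 0 < y k → j = k) :
    divSum y ∈ halfStar G i := by
  have hs := sum_pos_of_nonneg_of_pos hy hi
  refine ⟨⟨fun l => div_nonneg (hy l) hs.le, ?_⟩, ?_, fun j hj h => hG j hj ?_⟩
  · simp only [divSum]
    rw [← Finset.sum_div, div_self hs.ne']
  · rw [divSum, le_div_iff₀ hs]
    by_cases h : ∃ j, j ≠ i ∧ 0 < y j
    · obtain ⟨j, hji, hj⟩ := h
      have hsum : ∑ k, y k = y i + y j := Fintype.sum_eq_add i j hji.symm fun l hl =>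
        ((hy l).eq_or_lt.resolve_right fun h => hl.2 (huniq l j hl.1 hji h hj)).symm
      linarith [hmax j]
    · push Not at h
      have hsum : ∑ k, y k = y i :=
        Fintype.sum_eq_single i fun l hl => le_antisymm (h l hl) (hy l)
      linarith
  · exact (div_pos_iff_of_pos_right hs).1 h

theorem excess_nonneg (x : Fin n → ℝ) (l : Fin n) : 0 ≤ excess x l := le_max_left _ _

theorem lt_of_excess_pos {x : Fin n → ℝ} {l : Fin n} (h : 0 < excess x l) : thirdMax x < x l := by
  rcases lt_max_iff.1 h with h | h
  · exact absurd h (lt_irrefl _)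
  · exact sub_pos.1 h

theorem excess_pos_of_mem_halfStar {x : Fin n → ℝ} {i : Fin n} (hx : x ∈ halfStar G i) :
    0 < excess x i := by
  obtain ⟨⟨h0, h1⟩, hi, -⟩ := hx
  refine lt_max_of_lt_right (sub_pos.2 (lt_of_le_of_lt (thirdMax_le (c := 1 / 3) (by norm_num)
    fun a b c hab hbc hac => ?_) (by linarith)))
  have hsum : x a + x b + x c ≤ 1 := by
    rw [← h1, ← Finset.sum_pair hab, add_comm, ← Finset.sum_insert (by simp [hac.symm, hbc.symm])]
    exact Finset.sum_le_univ_sum_of_nonneg h0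
  by_contra! h
  obtain ⟨ha, hb, hc⟩ : 1 / 3 < x a ∧ 1 / 3 < x b ∧ 1 / 3 < x c := by
    simpa only [lt_min_iff] using h
  linarith

theorem divSum_excess_mem {x : Fin n → ℝ} {i : Fin n} (hx : x ∈ halfStar G i) :
    divSum (excess x) ∈ graphRealization G := by
  have hi := excess_pos_of_mem_halfStar hx
  refine divSum_mem_graphRealization (excess_nonneg x) hi (fun j hj h => hx.2.2 j hj
    (lt_of_le_of_lt NNReal.zero_le_coe (lt_of_excess_pos h))) fun j k hj hk h h' => ?_
  by_contra hjk
  exact absurd (min_le_thirdMax x hj.symm hjk hk.symm) (not_le.2 (lt_min (lt_of_excess_pos hi)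
    (lt_min (lt_of_excess_pos h) (lt_of_excess_pos h'))))

theorem mem_graphRealization_iff {t : Fin n → ℝ} :
    t ∈ graphRealization G ↔ ∃ i j, (i = j ∨ G.Adj i j) ∧ ∃ u ∈ Set.Icc (0 : ℝ) (1 / 2),
      t = (1 - u) • Pi.single i 1 + u • Pi.single j 1 := by
  constructor
  · rintro (⟨i, rfl⟩ | h)
    · exact ⟨i, i, Or.inl rfl, 0, by norm_num, by simp⟩
    · simp only [Set.mem_iUnion] at h
      obtain ⟨i, j, hij, a, b, ha, hb, hab, rfl⟩ := h
      rcases le_total b (1 / 2) with h | h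
      · exact ⟨i, j, Or.inr hij, b, ⟨hb, h⟩, by rw [← hab]; simp⟩
      · refine ⟨j, i, Or.inr hij.symm, a, ⟨ha, by linarith⟩, ?_⟩
        rw [← hab, add_comm (a • _)]; simp
  · rintro ⟨i, j, rfl | hij, u, ⟨hu0, hu1⟩, rfl⟩
    · exact Or.inl ⟨i, by simp [← add_smul]⟩
    · refine Or.inr ?_
      simp only [Set.mem_iUnion]
      exact ⟨i, j, hij, 1 - u, u, by linarith, hu0, by ring, rfl⟩

theorem halfEdge_mem_halfStar {i j : Fin n} (hij : i = j ∨ G.Adj i j) {u : ℝ}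
    (hu : u ∈ Set.Icc (0 : ℝ) (1 / 2)) :
    ((1 - u) • Pi.single i 1 + u • Pi.single j 1 : Fin n → ℝ) ∈ halfStar G i := by
  have hu0 := hu.1
  have hu1 := hu.2
  refine ⟨convex_stdSimplex ℝ (Fin n) (single_mem_stdSimplex ℝ i) (single_mem_stdSimplex ℝ j)
    (by linarith) hu0 (by ring), ?_, fun l hl h => ?_⟩
  · simp only [Pi.add_apply, Pi.smul_apply, smul_eq_mul, Pi.single_eq_same, Pi.single_apply]
    split_ifs <;> linarith
  · have hlj : l = j := by
      by_contra hlj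
      simp [hl, hlj] at h
    subst hlj
    exact hij.resolve_left hl.symm

theorem divSum_excess_of_mem {t : Fin n → ℝ} (ht : t ∈ graphRealization G) :
    divSum (excess t) = t := by
  obtain ⟨i, j, hij, u, hu, rfl⟩ := mem_graphRealization_iff.1 ht
  have hmem := halfEdge_mem_halfStar hij hu
  set t : Fin n → ℝ := (1 - u) • Pi.single i 1 + u • Pi.single j 1 with ht_def
  have h0 : (thirdMax t : ℝ) = 0 := by
    refine le_antisymm (thirdMax_le le_rfl fun a b c hab hbc hac => ?_) NNReal.zero_le_coe
    have hz : ∀ l, l ≠ i → l ≠ j → t l ≤ 0 := fun l hi hj => by simp [ht_def, hi, hj]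
    by_contra! h
    obtain ⟨ha, hb, hc⟩ : 0 < t a ∧ 0 < t b ∧ 0 < t c := by simpa only [lt_min_iff] using h
    have := hz a
    have := hz b
    have := hz c
    grind
  have he : excess t = t := funext fun l => by simp [excess, h0, hmem.1.1 l]
  rw [he]
  ext l
  simp [divSum, hmem.1.2]

/-- Two maps into a graph whose values always lie in a common half-star are homotopic. -/
theorem homotopic_of_forall_mem_halfStar {X : Type*} [TopologicalSpace X]
    (a b : C(X, graphRealization G))
    (h : ∀ x, ∃ i, (a x : Fin n → ℝ) ∈ halfStar G i ∧ (b x : Fin n → ℝ) ∈ halfStar G i) :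
    a.Homotopic b := by
  let c : unitInterval × X → Fin n → ℝ := fun p =>
    (1 - (p.1 : ℝ)) • (a p.2 : Fin n → ℝ) + (p.1 : ℝ) • (b p.2 : Fin n → ℝ)
  have hc : ∀ p, ∃ i, c p ∈ halfStar G i := fun p => by
    obtain ⟨i, ha, hb⟩ := h p.2
    exact ⟨i, convex_halfStar i ha hb (sub_nonneg.2 p.1.2.2) p.1.2.1 (by ring)⟩
  have hcont : Continuous fun p => divSum (excess (c p)) := by
    refine continuousOn_divSum.comp_continuous
      (continuous_excess.comp (by fun_prop)) fun p => ?_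
    obtain ⟨i, hi⟩ := hc p
    exact (sum_pos_of_nonneg_of_pos (excess_nonneg _) (excess_pos_of_mem_halfStar hi)).ne'
  have hmem : ∀ p, divSum (excess (c p)) ∈ graphRealization G := fun p => by
    obtain ⟨i, hi⟩ := hc p
    exact divSum_excess_mem hi
  refine ⟨⟨⟨fun p => ⟨divSum (excess (c p)), hmem p⟩, hcont.subtype_mk hmem⟩,
    fun x => Subtype.ext ?_, fun x => Subtype.ext ?_⟩⟩
  · simpa [c] using divSum_excess_of_mem (a x).2
  · simpa [c] using divSum_excess_of_mem (b x).2

end Retraction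

section Cover

variable {n : ℕ} {X : Type} [PseudoMetricSpace X] {A : Fin n → Set X} {G : SimpleGraph (Fin n)}

/-- Finitely many nonempty compact sets have a common scale below which their neighbourhoods
intersect a third set of the family only if the sets themselves do. -/
theorem exists_pos_le_max_infDist (hA : ∀ i, IsCompact (A i)) (hcl : ∀ i, IsClosed (A i))
    (hne : ∀ i, (A i).Nonempty) :
    ∃ ε > 0, ∀ i j k, A i ∩ A j ∩ A k = ∅ → ∀ x ∈ A i,
      ε ≤ max (Metric.infDist x (A j)) (Metric.infDist x (A k)) := by
  have key : ∀ i j k, ∀ᶠ ε in nhdsWithin (0 : ℝ) (Set.Ioi 0), A i ∩ A j ∩ A k = ∅ → ∀ x ∈ A i,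
      ε ≤ max (Metric.infDist x (A j)) (Metric.infDist x (A k)) := fun i j k => by
    by_cases h : A i ∩ A j ∩ A k = ∅
    · obtain ⟨x, hx, hmin⟩ := (hA i).exists_isMinOn (hne i)
        (f := fun x => max (Metric.infDist x (A j)) (Metric.infDist x (A k)))
        (((Metric.continuous_infDist_pt _).max (Metric.continuous_infDist_pt _)).continuousOn)
      have hpos : 0 < max (Metric.infDist x (A j)) (Metric.infDist x (A k)) := by
        by_contra! h0
        obtain ⟨hj, hk⟩ := max_le_iff.1 h0
        have mem : ∀ l, Metric.infDist x (A l) ≤ 0 → x ∈ A l := fun l hl =>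
          ((hcl l).mem_iff_infDist_zero (hne l)).2 (le_antisymm hl Metric.infDist_nonneg)
        exact Set.notMem_empty x (h ▸ ⟨⟨hx, mem j hj⟩, mem k hk⟩)
      filter_upwards [Ioo_mem_nhdsGT hpos] with ε hε _ y hy
      exact hε.2.le.trans (hmin hy)
    · exact Filter.Eventually.of_forall fun _ h' => absurd h' h
  have all := Filter.eventually_all.2 fun i => Filter.eventually_all.2 fun j =>
    Filter.eventually_all.2 fun k => key i j k
  obtain ⟨ε, h, hε⟩ := (all.and self_mem_nhdsWithin).exists
  exact ⟨ε, hε, h⟩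

/-- A space covered by compact sets without triple intersections maps to the intersection graph
of the cover so that each piece lands in the corresponding half-star. -/
theorem exists_map_graphRealization (hA : ∀ i, IsCompact (A i)) (hcl : ∀ i, IsClosed (A i))
    (hne : ∀ i, (A i).Nonempty) (hcover : ⋃ i, A i = Set.univ)
    (htriple : ∀ i j k, i ≠ j → j ≠ k → i ≠ k → A i ∩ A j ∩ A k = ∅)
    (hG : ∀ i j, i ≠ j → (A i ∩ A j).Nonempty → G.Adj i j) :
    ∃ f : C(X, graphRealization G), ∀ i, ∀ x ∈ A i, (f x : Fin n → ℝ) ∈ halfStar G i := by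
  obtain ⟨ε, hε, h⟩ := exists_pos_le_max_infDist hA hcl hne
  let w : X → Fin n → ℝ := fun x i => max 0 (ε - Metric.infDist x (A i))
  have hw : Continuous w := continuous_pi fun i =>
    continuous_const.max (continuous_const.sub (Metric.continuous_infDist_pt _))
  have hw0 : ∀ x l, 0 ≤ w x l := fun x l => le_max_left _ _
  have hwA : ∀ i, ∀ x ∈ A i, w x i = ε := fun i x hx => by
    simp [w, Metric.infDist_zero_of_mem hx, hε.le]
  have hwmax : ∀ x l, w x l ≤ ε := fun x l =>
    max_le hε.le (sub_le_self _ Metric.infDist_nonneg)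
  have hlt : ∀ x l, 0 < w x l → Metric.infDist x (A l) < ε := fun x l hl => by
    rcases lt_max_iff.1 hl with hl | hl
    · exact absurd hl (lt_irrefl _)
    · exact sub_pos.1 hl
  have hwG : ∀ i, ∀ x ∈ A i, ∀ j, j ≠ i → 0 < w x j → G.Adj i j := fun i x hx j hj hpos => by
    refine hG i j hj.symm ?_
    by_contra hempty
    rw [Set.not_nonempty_iff_eq_empty] at hempty
    have := h i j j (by rw [hempty, Set.empty_inter]) x hx
    rw [max_self] at this
    exact absurd this (not_le.2 (hlt x j hpos))
  have huniq : ∀ i, ∀ x ∈ A i, ∀ j k, j ≠ i → k ≠ i → 0 < w x j → 0 < w x k → j = k :=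
    fun i x hx j k hj hk hwj hwk => by
      by_contra hjk
      exact absurd (h i j k (htriple i j k hj.symm hjk hk.symm) x hx)
        (not_le.2 (max_lt (hlt x j hwj) (hlt x k hwk)))
  have hex : ∀ x, ∃ i, x ∈ A i := fun x => Set.mem_iUnion.1 (hcover ▸ Set.mem_univ x)
  have hmem : ∀ x, divSum (w x) ∈ graphRealization G := fun x => by
    obtain ⟨i, hi⟩ := hex x
    exact divSum_mem_graphRealization (hw0 x) (by rw [hwA i x hi]; exact hε) (hwG i x hi)
      (huniq i x hi)
  have hcont : Continuous fun x => divSum (w x) :=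
    continuousOn_divSum.comp_continuous hw fun x => by
      obtain ⟨i, hi⟩ := hex x
      exact (sum_pos_of_nonneg_of_pos (hw0 x) (i := i) (by rw [hwA i x hi]; exact hε)).ne'
  refine ⟨⟨fun x => ⟨divSum (w x), hmem x⟩, hcont.subtype_mk hmem⟩, fun i x hi => ?_⟩
  exact divSum_mem_halfStar (hw0 x) (by rw [hwA i x hi]; exact hε)
    (fun j => by rw [hwA i x hi]; exact hwmax x j) (hwG i x hi) (huniq i x hi)

/-- Two half-edges of the realization of a graph meet only in the evident ways. -/
theorem halfEdge_eq_halfEdge {i j i' j' : Fin n} {u u' : ℝ} (hu : u ∈ Set.Icc (0 : ℝ) (1 / 2))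
    (hu' : u' ∈ Set.Icc (0 : ℝ) (1 / 2))
    (h : ((1 - u) • Pi.single i 1 + u • Pi.single j 1 : Fin n → ℝ) =
      (1 - u') • Pi.single i' 1 + u' • Pi.single j' 1) :
    (i = i' ∧ (i = j ∨ u = 0) ∧ (i' = j' ∨ u' = 0)) ∨ (i = i' ∧ j = j' ∧ u = u') ∨
      (j = i' ∧ i = j' ∧ u = 1 / 2 ∧ u' = 1 / 2) := by
  obtain ⟨hu0, hu1⟩ := hu
  obtain ⟨hu0', hu1'⟩ := hu'
  have hi := congrFun h i
  have hj := congrFun h j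
  have hi' := congrFun h i'
  have hj' := congrFun h j'
  simp only [Pi.add_apply, Pi.smul_apply, smul_eq_mul, Pi.single_apply] at hi hj hi' hj'
  clear h
  by_cases h1 : i = i' <;> by_cases h2 : i = j <;> by_cases h3 : i' = j' <;>
    by_cases h4 : j = i' <;> by_cases h5 : i = j' <;> by_cases h6 : j = j' <;> grind

/-- The intersection graph of a cover by path-connected sets maps to the covered space so that
each half-edge at a vertex lands in the corresponding piece. -/
theorem exists_map_of_graphRealization (hp : ∀ i, IsPathConnected (A i))
    (hG : ∀ i j, G.Adj i j → (A i ∩ A j).Nonempty) :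
    ∃ g : C(graphRealization G, X), ∀ t : graphRealization G, ∃ i, (t : Fin n → ℝ) ∈ halfStar G i ∧ g t ∈ A i := by
  have hpt : ∀ i j, ∃ p, (i = j ∨ G.Adj i j) → p ∈ A i ∩ A j := fun i j => by
    by_cases h : i = j ∨ G.Adj i j
    · rcases h with rfl | h
      · exact (hp i).nonempty.imp fun x hx _ => ⟨hx, hx⟩
      · exact (hG i j h).imp fun x hx _ => hx
    · obtain ⟨x, -⟩ := (hp i).nonempty
      exact ⟨x, fun h' => absurd h' h⟩
  choose q hq using hpt
  let p : Fin n → Fin n → X := fun i j => q (min i j) (max i j)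
  have hpsymm : ∀ i j, p i j = p j i := fun i j => by simp only [p, min_comm, max_comm]
  have hpA : ∀ i j, (i = j ∨ G.Adj i j) → p i j ∈ A i := fun i j hij => by
    rcases le_total i j with h | h
    · simpa [p, h] using (hq i j hij).1
    · simpa [p, h] using (hq j i (hij.imp Eq.symm SimpleGraph.Adj.symm)).2
  let I := {e : Fin n × Fin n // e.1 = e.2 ∨ G.Adj e.1 e.2}
  have hpath : ∀ e : I, ∃ γ : Path (p e.1.1 e.1.1) (p e.1.1 e.1.2),
      (∀ s, γ s ∈ A e.1.1) ∧ (e.1.1 = e.1.2 → ∀ s, γ s = p e.1.1 e.1.1) := fun e => by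
    by_cases he : e.1.1 = e.1.2
    · refine ⟨(Path.refl _).cast rfl (by rw [← he]), fun s => ?_, fun _ s => ?_⟩
      · simpa using hpA _ _ (Or.inl rfl)
      · simp
    · obtain ⟨γ, hγ⟩ := (hp e.1.1).joinedIn _ (hpA _ _ (Or.inl rfl)) _ (hpA _ _ e.2)
      exact ⟨γ, hγ, fun h => absurd h he⟩
  choose γ hγA hγ using hpath
  let J := Set.Icc (0 : ℝ) (1 / 2)
  let Q : (Σ _ : I, J) → graphRealization G := fun s =>
    ⟨(1 - s.2.1) • Pi.single s.1.1.1 1 + s.2.1 • Pi.single s.1.1.2 1,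
      mem_graphRealization_iff.2 ⟨_, _, s.1.2, s.2.1, s.2.2, rfl⟩⟩
  have hQcont : Continuous Q := continuous_sigma fun e => by
    exact Continuous.subtype_mk (f := fun u : J => ((1 - u.1) • Pi.single e.1.1 1 +
      u.1 • Pi.single e.1.2 1 : Fin n → ℝ)) (by fun_prop) _
  have hQsurj : Function.Surjective Q := fun t => by
    obtain ⟨i, j, hij, u, hu, ht⟩ := mem_graphRealization_iff.1 t.2
    exact ⟨⟨⟨(i, j), hij⟩, ⟨u, hu⟩⟩, Subtype.ext ht.symm⟩
  have hQ : Topology.IsQuotientMap Q := IsClosedMap.isQuotientMap hQcont.isClosedMap hQcont hQsurj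
  let P : C((Σ _ : I, J), X) :=
    ⟨fun s => (γ s.1).extend (2 * s.2.1), continuous_sigma fun e => by
      exact (γ e).continuous_extend.comp (by fun_prop)⟩
  have hPA : ∀ s, P s ∈ A s.1.1.1 := fun s => hγA s.1 _
  have hP0 : ∀ s : Σ _ : I, J, (s.1.1.1 = s.1.1.2 ∨ s.2.1 = 0) → P s = p s.1.1.1 s.1.1.1 := by
    rintro ⟨e, u⟩ (h | h)
    · exact hγ e h _
    · change (γ e).extend (2 * u.1) = _
      rw [show u.1 = 0 from h, mul_zero, Path.extend_zero]
  have hP1 : ∀ s : Σ _ : I, J, s.2.1 = 1 / 2 → P s = p s.1.1.1 s.1.1.2 := by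
    rintro ⟨e, u⟩ h
    change (γ e).extend (2 * u.1) = _
    rw [show u.1 = 1 / 2 from h, mul_one_div_cancel two_ne_zero, Path.extend_one]
  have hcompat : ∀ s s', Q s = Q s' → P s = P s' := by
    intro s s' hss
    rcases halfEdge_eq_halfEdge s.2.2 s'.2.2 (congrArg Subtype.val hss) with
      ⟨h, h1, h2⟩ | ⟨h, h1, h2⟩ | ⟨h, h1, h2, h3⟩
    · rw [hP0 s h1, hP0 s' h2, h]
    · have : s = s' := Sigma.ext (Subtype.ext (Prod.ext h h1)) (heq_of_eq (Subtype.ext h2))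
      rw [this]
    · rw [hP1 s h2, hP1 s' h3, ← h, ← h1, hpsymm]
  let g : C(graphRealization G, X) := Topology.IsQuotientMap.lift (f := ⟨Q, hQcont⟩) hQ P
    (fun s s' hss => hcompat s s' hss)
  have hg : ∀ s, g (Q s) = P s := fun s =>
    DFunLike.congr_fun (Topology.IsQuotientMap.lift_comp (f := ⟨Q, hQcont⟩) hQ P
      (fun s s' hss => hcompat s s' hss)) s
  refine ⟨g, fun t => ?_⟩
  obtain ⟨s, rfl⟩ := hQsurj t
  exact ⟨s.1.1.1, halfEdge_mem_halfStar s.1.2 s.2.2, by rw [hg]; exact hPA s⟩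

/-- The nerve theorem for covers without triple intersections, in the form of a lower bound: the
realization of the intersection graph has homology of dimension at most that of the space. -/
theorem rank_singularHomology_graphRealization_le (F : Type) [Field F] (m : ℕ)
    (hA : ∀ i, IsCompact (A i)) (hcl : ∀ i, IsClosed (A i)) (hp : ∀ i, IsPathConnected (A i))
    (hcover : ⋃ i, A i = Set.univ)
    (htriple : ∀ i j k, i ≠ j → j ≠ k → i ≠ k → A i ∩ A j ∩ A k = ∅)
    (hG : ∀ i j, G.Adj i j ↔ i ≠ j ∧ (A i ∩ A j).Nonempty) :
    Module.rank F ((singularHomologyFunctor F m).obj (TopCat.of (graphRealization G))) ≤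
      Module.rank F ((singularHomologyFunctor F m).obj (TopCat.of X)) := by
  obtain ⟨f, hf⟩ := exists_map_graphRealization (G := G) hA hcl (fun i => (hp i).nonempty) hcover
    htriple fun i j hij h => (hG i j).2 ⟨hij, h⟩
  obtain ⟨g, hg⟩ := exists_map_of_graphRealization hp fun i j h => ((hG i j).1 h).2
  obtain ⟨H⟩ := homotopic_of_forall_mem_halfStar (f.comp g) (ContinuousMap.id _) fun t =>
    (hg t).imp fun i h => ⟨hf i _ h.2, h.1⟩
  exact rank_singularHomology_le_of_homotopy_retract F m g f H

end Cover

/-- Let the finite simplicial complex `K` be the union of nonempty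
connected subcomplexes `K₁, …, Kₙ` with all triple intersections of their realizations
empty, and let `G` be the intersection graph of the `|Kᵢ|` (an edge `{i,j}` whenever
`|Kᵢ| ∩ |Kⱼ| ≠ ∅`). Then, for any field `F`, the dimension of `H₁(|K|; F)` is at least
the dimension of `H₁(G; F)` (the first singular homology of the geometric realization of
the graph `G`). -/
theorem H1_dimension_lower_bound
    (F : Type) [Field F] (d n : ℕ)
    (K : Geometry.SimplicialComplex ℝ (Fin d → ℝ))
    (Ks : Fin n → Geometry.SimplicialComplex ℝ (Fin d → ℝ))
    (hfin : K.faces.Finite)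
    (hsub : ∀ i, (Ks i).faces ⊆ K.faces)
    (hne : ∀ i, (Ks i).faces.Nonempty)
    (hconn : ∀ i, _root_.IsConnected (Ks i).space)
    (hunion : K.faces = ⋃ i, (Ks i).faces)
    (htriple : ∀ i j k : Fin n, i ≠ j → j ≠ k → i ≠ k →
      (Ks i).space ∩ (Ks j).space ∩ (Ks k).space = ∅)
    (G : SimpleGraph (Fin n))
    (hG : ∀ i j, G.Adj i j ↔ i ≠ j ∧ ((Ks i).space ∩ (Ks j).space).Nonempty) :
    Module.rank F
        ((singularHomologyFunctor F 1).obj (TopCat.of (graphRealization G)))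
      ≤ Module.rank F ((singularHomologyFunctor F 1).obj (TopCat.of K.space)) := by
  have hfin' : ∀ i, (Ks i).faces.Finite := fun i => hfin.subset (hsub i)
  have hspace : K.space = ⋃ i, (Ks i).space := by
    simp only [Geometry.SimplicialComplex.space, hunion, Set.biUnion_iUnion]
  have hemb : ∀ i, Subtype.val '' (Subtype.val ⁻¹' (Ks i).space : Set K.space) = (Ks i).space :=
    fun i => by
      rw [Subtype.image_preimage_coe, Set.inter_eq_right, hspace]
      exact Set.subset_iUnion (fun i => (Ks i).space) i
  have hcomp : ∀ i, IsCompact (Ks i).space := fun i =>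
    Geometry.SimplicialComplex.isCompact_space (hfin' i)
  refine rank_singularHomology_graphRealization_le
    (A := fun i => (Subtype.val ⁻¹' (Ks i).space : Set K.space)) F 1 (fun i => ?_)
    (fun i => (hcomp i).isClosed.preimage continuous_subtype_val) (fun i => ?_) ?_
    (fun i j k hij hjk hik => ?_) fun i j => (hG i j).trans (and_congr_right fun _ => ?_)
  · rw [Subtype.isCompact_iff, hemb]
    exact hcomp i
  · rw [Topology.IsInducing.subtypeVal.isPathConnected_iff, hemb]
    exact Geometry.SimplicialComplex.isPathConnected_space (hfin' i) (hconn i)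
  · rw [← Set.preimage_iUnion, ← hspace, Subtype.coe_preimage_self]
  · rw [← Set.preimage_inter, ← Set.preimage_inter, htriple i j k hij hjk hik, Set.preimage_empty]
  · conv_lhs => rw [← hemb i]
    rw [← Set.image_inter_preimage, Set.image_nonempty]
end

section
/- There exists an absolute constant C such that for every nonzero polynomial f ∈ ℝ[x,y,z] of degree at most D (D ≥ 1), the first Betti number of the complement of its zero set satisfies dim_{ℤ/2} H₁(ℝ³ \ Z(f); ℤ/2) ≤ C·D³. -/
open CategoryTheory

/-- The real zero set of a polynomial `f ∈ ℝ[x,y,z]`. -/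
def ZeroSet (f : MvPolynomial (Fin 3) ℝ) : Set (Fin 3 → ℝ) :=
  {p | MvPolynomial.eval p f = 0}

open unitInterval in
/-- Singular 1-chains modulo two, with 1-simplices parametrised by the unit interval. -/
abbrev PathChain (X : Type) [TopologicalSpace X] : Type := C(I, X) →₀ ZMod 2

namespace PathChain

open unitInterval

variable {X : Type} [TopologicalSpace X]

/-- The boundary of a path chain. -/
noncomputable def boundary (X : Type) [TopologicalSpace X] :
    PathChain X →ₗ[ZMod 2] (X →₀ ZMod 2) :=
  Finsupp.lmapDomain (ZMod 2) (ZMod 2) (fun γ : C(I, X) ↦ γ 0) +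
    Finsupp.lmapDomain (ZMod 2) (ZMod 2) (fun γ : C(I, X) ↦ γ 1)

/-- The `i`-th side of a singular triangle. -/
noncomputable def side (τ : C(stdSimplex ℝ (Fin 3), X)) (i : Fin 3) : C(I, X) :=
  (τ.comp ⟨stdSimplex.map i.succAbove, stdSimplex.continuous_map _⟩).comp
    (stdSimplexHomeomorphUnitInterval.symm : C(I, stdSimplex ℝ (Fin 2)))

/-- The chains bounding singular 2-chains. -/
noncomputable def boundaries (X : Type) [TopologicalSpace X] : Submodule (ZMod 2) (PathChain X) :=
  Submodule.span (ZMod 2)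
    (Set.range fun τ : C(stdSimplex ℝ (Fin 3), X) ↦ ∑ i, Finsupp.single (side τ i) 1)

/-- The chains carried by a subset. -/
def chainsIn (S : Set X) : Submodule (ZMod 2) (PathChain X) :=
  Finsupp.supported (ZMod 2) (ZMod 2) {γ | ∀ t, γ t ∈ S}

/-- The classes of `X` in degree one that are represented by cycles carried by `S`. -/
noncomputable def classesIn (S : Set X) : Submodule (ZMod 2) (PathChain X ⧸ boundaries X) :=
  (chainsIn S ⊓ LinearMap.ker (boundary X)).map (boundaries X).mkQ

/-- The singular 1-simplices of `X` are paths. -/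
noncomputable def simplexEquiv (X : Type) [TopologicalSpace X] :
    C(I, X) ≃ (TopCat.toSSet.obj (TopCat.of X)).obj (.op (SimplexCategory.mk 1)) :=
  (stdSimplexHomeomorphUnitInterval.symm.continuousMapCongr (.refl X)).trans
    (TopCat.toSSetObjEquiv (TopCat.of X) (.op (SimplexCategory.mk 1))).symm

/-- The singular 0-simplices of `X` are points. -/
noncomputable def pointEquiv (X : Type) [TopologicalSpace X] :
    (TopCat.toSSet.obj (TopCat.of X)).obj (.op (SimplexCategory.mk 0)) ≃ X :=
  (TopCat.toSSetObjEquiv (TopCat.of X) (.op (SimplexCategory.mk 0))).trans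
    { toFun := fun γ ↦ γ default
      invFun := fun x ↦ .const _ x
      left_inv := fun γ ↦ by ext t; simp [Subsingleton.elim t default]
      right_inv := fun x ↦ rfl }

/-- The singular chain complex computing `singularHomologyFunctor`. -/
noncomputable abbrev singularComplex (X : Type) [TopologicalSpace X] :
    ChainComplex (ModuleCat (ZMod 2)) ℕ :=
  (TopCat.toSSet ⋙ ((SimplicialObject.whiskering _ _).obj (ModuleCat.free (ZMod 2))) ⋙
    AlgebraicTopology.alternatingFaceMapComplex _).obj (TopCat.of X)


open Simplicial in
lemma singularComplex_d_single (n : ℕ) (x : (TopCat.toSSet.obj (TopCat.of X)) _⦋n + 1⦌) :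
    ((singularComplex X).d (n + 1) n).hom (Finsupp.single x (1 : ZMod 2)) =
      ∑ i, (Finsupp.single ((TopCat.toSSet.obj (TopCat.of X)).δ i x) (1 : ZMod 2) :
        (TopCat.toSSet.obj (TopCat.of X)) _⦋n⦌ →₀ ZMod 2) := by
  have h : (singularComplex X).d (n + 1) n = ∑ i : Fin (n + 2), (-1 : ℤ) ^ (i : ℕ) •
      (ModuleCat.free (ZMod 2)).map ((TopCat.toSSet.obj (TopCat.of X)).δ i) :=
    AlgebraicTopology.AlternatingFaceMapComplex.obj_d_eq _ n
  have hsum (A B : ModuleCat (ZMod 2)) (s : Fin (n + 2) → (A ⟶ B)) (v : A) :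
      (∑ i : Fin (n + 2), (-1 : ℤ) ^ (i : ℕ) • s i).hom v = ∑ i, (s i).hom v := by
    rw [ModuleCat.hom_sum, LinearMap.sum_apply]
    refine Finset.sum_congr rfl fun i _ ↦ ?_
    rw [ModuleCat.hom_zsmul, LinearMap.smul_apply]
    rcases neg_one_pow_eq_or ℤ (i : ℕ) with h | h <;> rw [h]
    · exact one_smul _ _
    · rw [neg_one_smul, ZModModule.neg_eq_self]
  rw [h]
  exact (hsum _ _ _ _).trans (Finset.sum_congr rfl fun i _ ↦ Finsupp.mapDomain_single)

/-- Path chains are the singular 1-chains. -/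
noncomputable def chainEquiv (X : Type) [TopologicalSpace X] :
    PathChain X ≃ₗ[ZMod 2] (singularComplex X).X 1 :=
  Finsupp.domLCongr (simplexEquiv X)

lemma chainEquiv_single (γ : C(I, X)) :
    chainEquiv X (Finsupp.single γ 1) = Finsupp.single (simplexEquiv X γ) (1 : ZMod 2) :=
  Finsupp.domLCongr_single _ _ _

/-- Finitely supported functions on points are the singular 0-chains. -/
noncomputable def pointChainEquiv (X : Type) [TopologicalSpace X] :
    (singularComplex X).X 0 ≃ₗ[ZMod 2] (X →₀ ZMod 2) :=
  Finsupp.domLCongr (pointEquiv X)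

lemma pointEquiv_δ (γ : C(I, X)) (i : Fin 2) :
    pointEquiv X ((TopCat.toSSet.obj (TopCat.of X)).δ i (simplexEquiv X γ)) =
      γ (if i = 0 then 1 else 0) := by
  refine (TopCat.toSSetObjEquiv_δ_apply (X := TopCat.of X) (n := 0) (simplexEquiv X γ) i
    (default : stdSimplex ℝ (Fin 1))).trans ?_
  simp only [simplexEquiv, Equiv.trans_apply, Equiv.apply_symm_apply]
  change γ (stdSimplexHomeomorphUnitInterval (stdSimplex.map i.succAbove default)) = _
  congr 1
  ext
  fin_cases i <;> simp [stdSimplexHomeomorphUnitInterval, stdSimplexEquivIcc, stdSimplex.map,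
    FunOnFinite.linearMap_apply_apply, Finset.univ_unique]
  rfl

lemma boundary_single (γ : C(I, X)) :
    boundary X (Finsupp.single γ 1) = Finsupp.single (γ 0) 1 + Finsupp.single (γ 1) 1 := by
  simp [boundary]

lemma d_chainEquiv (c : PathChain X) :
    pointChainEquiv X (((singularComplex X).d 1 0).hom (chainEquiv X c)) = boundary X c := by
  suffices h : (pointChainEquiv X).toLinearMap ∘ₗ ((singularComplex X).d 1 0).hom ∘ₗ
      (chainEquiv X).toLinearMap = boundary X from DFunLike.congr_fun h c
  refine Finsupp.lhom_ext' fun γ ↦ LinearMap.ext_ring ?_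
  change pointChainEquiv X (((singularComplex X).d 1 0).hom (chainEquiv X (Finsupp.single γ 1))) =
    boundary X (Finsupp.single γ 1)
  rw [boundary_single, chainEquiv_single, singularComplex_d_single, Fin.sum_univ_two,
    add_comm]
  refine (map_add (pointChainEquiv X) _ _).trans (congr_arg₂ _ ?_ ?_) <;> refine (Finsupp.domLCongr_single _ _ _).trans ?_ <;>
    rw [pointEquiv_δ] <;> rfl

lemma simplexEquiv_side (τ : C(stdSimplex ℝ (Fin 3), X)) (i : Fin 3) :
    simplexEquiv X (side τ i) = (TopCat.toSSet.obj (TopCat.of X)).δ i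
      ((TopCat.toSSetObjEquiv (TopCat.of X) (.op (SimplexCategory.mk 2))).symm τ) := by
  apply (TopCat.toSSetObjEquiv (TopCat.of X) (.op (SimplexCategory.mk 1))).injective
  ext t
  refine Eq.trans ?_ (TopCat.toSSetObjEquiv_δ_apply (X := TopCat.of X) (n := 1) _ i t).symm
  simp only [simplexEquiv, Equiv.trans_apply, Equiv.apply_symm_apply]
  change τ (stdSimplex.map _ (stdSimplexHomeomorphUnitInterval.symm
    (stdSimplexHomeomorphUnitInterval t))) = _
  simp

lemma map_boundaries_le :
    (boundaries X).map (chainEquiv X).toLinearMap ≤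
      LinearMap.range ((singularComplex X).d 2 1).hom := by
  rw [boundaries, Submodule.map_span_le]
  rintro _ ⟨τ, rfl⟩
  refine ⟨Finsupp.single ((TopCat.toSSetObjEquiv (TopCat.of X)
    (.op (SimplexCategory.mk 2))).symm τ) (1 : ZMod 2), ?_⟩
  rw [singularComplex_d_single, LinearEquiv.coe_coe, map_sum]
  refine Finset.sum_congr rfl fun i _ ↦ ?_
  rw [chainEquiv_single, simplexEquiv_side]

lemma rank_quotient_le {R A B C P : Type} [Field R] [AddCommGroup A] [Module R A]
    [AddCommGroup B] [Module R B] [AddCommGroup C] [Module R C] [AddCommGroup P] [Module R P]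
    (e : P ≃ₗ[R] B) (f : A →ₗ[R] B) (g : B →ₗ[R] C) (f' : A →ₗ[R] LinearMap.ker g)
    (hf' : ∀ a, (f' a : B) = f a)
    (Z S : Submodule R P) (hZ : ∀ z, g (e z) = 0 → z ∈ Z)
    (hS : S.map e.toLinearMap ≤ LinearMap.range f) :
    Module.rank R (LinearMap.ker g ⧸ LinearMap.range f') ≤ Module.rank R (Z.map S.mkQ) := by
  let φ : LinearMap.ker g ⧸ LinearMap.range f' →ₗ[R] B ⧸ LinearMap.range f :=
    Submodule.mapQ _ _ (LinearMap.ker g).subtype (by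
      rintro _ ⟨a, rfl⟩
      exact ⟨a, (hf' a).symm⟩)
  have hφ : Function.Injective φ := by
    rw [← LinearMap.ker_eq_bot, LinearMap.ker_eq_bot']
    intro x hx
    obtain ⟨x, rfl⟩ := Submodule.Quotient.mk_surjective _ x
    obtain ⟨a, ha⟩ := (Submodule.Quotient.mk_eq_zero _).1 hx
    exact (Submodule.Quotient.mk_eq_zero _).2 ⟨a, Subtype.ext ((hf' a).trans ha)⟩
  let ψ : P ⧸ S →ₗ[R] B ⧸ LinearMap.range f :=
    Submodule.mapQ _ _ e.toLinearMap (Submodule.map_le_iff_le_comap.1 hS)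
  have h : LinearMap.range φ ≤ (Z.map S.mkQ).map ψ := by
    rintro _ ⟨x, rfl⟩
    obtain ⟨x, rfl⟩ := Submodule.Quotient.mk_surjective _ x
    refine ⟨_, ⟨e.symm x, hZ _ (by simp), rfl⟩, ?_⟩
    simp only [ψ, φ, Submodule.mkQ_apply, Submodule.mapQ_apply]
    simp
  calc _ = Module.rank R (LinearMap.range φ) := (rank_range_of_injective φ hφ).symm
    _ ≤ _ := (Submodule.rank_mono h).trans (rank_map_le _ _)

/-- The rank of singular homology in degree one is the rank of the space of classes of
cyclic path chains. -/
theorem rank_singularHomology_le (X : Type) [TopologicalSpace X] :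
    Module.rank (ZMod 2) ((singularHomologyFunctor (ZMod 2) 1).obj (TopCat.of X)) ≤
      Module.rank (ZMod 2) (classesIn (Set.univ : Set X)) := by
  let S := (singularComplex X).sc' 2 1 0
  let i : (singularHomologyFunctor (ZMod 2) 1).obj (TopCat.of X) ≅ S.moduleCatLeftHomologyData.H :=
    ShortComplex.homologyMapIso ((singularComplex X).isoSc' 2 1 0 (by simp) (by simp)) ≪≫
      S.moduleCatHomologyIso
  rw [i.toLinearEquiv.rank_eq]
  refine rank_quotient_le (chainEquiv X) S.f.hom S.g.hom S.moduleCatToCycles (fun a ↦ rfl) _ _ ?_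
    map_boundaries_le
  intro z hz
  refine ⟨by simp [chainsIn], ?_⟩
  rw [SetLike.mem_coe, LinearMap.mem_ker, ← d_chainEquiv]
  exact (congr_arg _ hz).trans (map_zero _)

lemma boundaries_le_ker : boundaries X ≤ LinearMap.ker (boundary X) := by
  intro c hc
  obtain ⟨b, hb⟩ := map_boundaries_le (Submodule.mem_map_of_mem hc)
  rw [LinearMap.mem_ker, ← d_chainEquiv, ← LinearEquiv.coe_coe (chainEquiv X), ← hb]
  have h := congr_arg (fun f ↦ f.hom b) ((singularComplex X).d_comp_d 2 1 0)
  exact (congr_arg _ h).trans (map_zero _)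

/-- The class of a path modulo boundaries. -/
noncomputable def cls (γ : C(I, X)) : PathChain X ⧸ boundaries X :=
  (boundaries X).mkQ (Finsupp.single γ 1)

/-- The image of a straight segment under a continuous map. -/
def seg {E : Type*} [AddCommGroup E] [Module ℝ E] [TopologicalSpace E] [ContinuousAdd E]
    [ContinuousSMul ℝ E] (F : C(E, X)) (a b : E) : C(I, X) where
  toFun t := F ((1 - (t : ℝ)) • a + (t : ℝ) • b)

section

variable {E : Type*} [AddCommGroup E] [Module ℝ E] [TopologicalSpace E] [ContinuousAdd E]
    [ContinuousSMul ℝ E] (F : C(E, X)) (a b c : E)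

lemma stdSimplex_map_apply {m n : ℕ} (f : Fin m → Fin n) (s : stdSimplex ℝ (Fin m)) (k : Fin n) :
    (stdSimplex.map f s).1 k = ∑ j, if f j = k then s.1 j else 0 := by
  rw [← Finset.sum_filter]
  exact FunOnFinite.linearMap_apply_apply ..

lemma cls_triangle : cls (seg F b c) + cls (seg F a c) + cls (seg F a b) = 0 := by
  let τ : C(stdSimplex ℝ (Fin 3), X) :=
    ⟨fun s ↦ F (s.1 0 • a + s.1 1 • b + s.1 2 • c), F.continuous.comp <| by
      have (i : Fin 3) : Continuous fun s : stdSimplex ℝ (Fin 3) ↦ s.1 i :=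
        (continuous_apply i).comp continuous_subtype_val
      exact (((this 0).smul continuous_const).add ((this 1).smul continuous_const)).add
        ((this 2).smul continuous_const)⟩
  have h : ∑ i, Finsupp.single (side τ i) (1 : ZMod 2) ∈ boundaries X :=
    Submodule.subset_span ⟨τ, rfl⟩
  have hside (i : Fin 3) (t : I) (k : Fin 3) :
      (stdSimplex.map i.succAbove (stdSimplexHomeomorphUnitInterval.symm t)).1 k =
        (if i.succAbove 0 = k then 1 - (t : ℝ) else 0) + if i.succAbove 1 = k then (t : ℝ) else 0 := by
    rw [stdSimplex_map_apply, Fin.sum_univ_two]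
    rfl
  have hτ (i : Fin 3) (t : I) : side τ i t = F
      ((stdSimplex.map i.succAbove (stdSimplexHomeomorphUnitInterval.symm t)).1 0 • a +
      (stdSimplex.map i.succAbove (stdSimplexHomeomorphUnitInterval.symm t)).1 1 • b +
      (stdSimplex.map i.succAbove (stdSimplexHomeomorphUnitInterval.symm t)).1 2 • c) := rfl
  have h0 : side τ 0 = seg F b c := by
    ext t
    rw [hτ]
    simp only [hside]
    simp [seg]
  have h1 : side τ 1 = seg F a c := by
    ext t
    rw [hτ]
    simp only [hside]
    simp [seg, Fin.succAbove]
  have h2 : side τ 2 = seg F a b := by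
    ext t
    rw [hτ]
    simp only [hside]
    simp [seg, Fin.succAbove]
  have := (Submodule.Quotient.mk_eq_zero _).2 h
  rw [Fin.sum_univ_three, h0, h1, h2] at this
  exact this

end

lemma cls_const (x : X) : cls (.const I x) = 0 := by
  have h := cls_triangle (ContinuousMap.const ℝ x) 0 0 0
  have h' : seg (ContinuousMap.const ℝ x) 0 0 = .const I x := rfl
  rwa [h', ZModModule.add_self, zero_add] at h

lemma cls_square (F : C(I × I, X)) :
    cls (F.comp ⟨fun s ↦ (s, 0), by fun_prop⟩) = cls (F.comp ⟨fun s ↦ (s, 1), by fun_prop⟩) +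
      (cls (F.comp ⟨fun s ↦ (0, s), by fun_prop⟩) +
        cls (F.comp ⟨fun s ↦ (1, s), by fun_prop⟩)) := by
  let G : C(ℝ × ℝ, X) := F.comp
    ⟨fun p ↦ (Set.projIcc 0 1 zero_le_one p.1, Set.projIcc 0 1 zero_le_one p.2), by fun_prop⟩
  have h1 := cls_triangle G (0, 0) (1, 0) (1, 1)
  have h2 := cls_triangle G (0, 0) (0, 1) (1, 1)
  have e1 : seg G (0, 0) (1, 0) = F.comp ⟨fun s ↦ (s, 0), by fun_prop⟩ := by
    ext s; simp [seg, G]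
  have e2 : seg G (0, 1) (1, 1) = F.comp ⟨fun s ↦ (s, 1), by fun_prop⟩ := by
    ext s; simp [seg, G]
  have e3 : seg G (0, 0) (0, 1) = F.comp ⟨fun s ↦ (0, s), by fun_prop⟩ := by
    ext s; simp [seg, G]
  have e4 : seg G (1, 0) (1, 1) = F.comp ⟨fun s ↦ (1, s), by fun_prop⟩ := by
    ext s; simp [seg, G]
  rw [e1, e4] at h1
  rw [e2, e3] at h2
  have neg (u : PathChain X ⧸ boundaries X) : -u = u := ZModModule.neg_eq_self u
  rw [eq_neg_of_add_eq_zero_right h1, neg]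
  rw [add_assoc, add_comm, add_assoc] at h2
  rw [eq_neg_of_add_eq_zero_left h2, neg]
  abel

lemma chainsIn_mono {S T : Set X} (h : S ⊆ T) : chainsIn S ≤ chainsIn T :=
  Finsupp.supported_mono fun _ hγ t ↦ h (hγ t)

lemma classesIn_mono {S T : Set X} (h : S ⊆ T) : classesIn S ≤ classesIn T :=
  Submodule.map_mono (inf_le_inf_right _ (chainsIn_mono h))

lemma single_mem_chainsIn {S : Set X} {γ : C(I, X)} (h : ∀ t, γ t ∈ S) :
    Finsupp.single γ 1 ∈ chainsIn S :=
  Finsupp.single_mem_supported _ _ h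

lemma chainsIn_induction {S : Set X} {P : PathChain X → Prop} (h0 : P 0)
    (hadd : ∀ c d, P c → P d → P (c + d)) (h1 : ∀ γ : C(I, X), (∀ t, γ t ∈ S) →
      P (Finsupp.single γ 1)) {c : PathChain X} (hc : c ∈ chainsIn S) : P c := by
  rw [chainsIn, Finsupp.supported_eq_span_single] at hc
  induction hc using Submodule.span_induction with
  | mem x hx => obtain ⟨γ, hγ, rfl⟩ := hx; exact h1 γ hγ
  | zero => exact h0
  | add x y _ _ hx hy => exact hadd x y hx hy
  | smul a x _ hx =>
    have : a = 0 ∨ a = 1 := by revert a; decide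
    rcases this with rfl | rfl
    · simpa using h0
    · simpa using hx

lemma classesIn_singleton (x : X) : classesIn {x} = ⊥ := by
  rw [eq_bot_iff]
  rintro _ ⟨c, ⟨hc, -⟩, rfl⟩
  refine chainsIn_induction (P := fun c ↦ (boundaries X).mkQ c ∈ ⊥) ?_ ?_ ?_ hc
  · simp
  · intro c d hc hd
    rw [map_add]
    exact add_mem hc hd
  · intro γ hγ
    have : γ = .const I x := by ext t; exact hγ t
    rw [this]
    exact cls_const x

/-- Homologous cycles: a set of classes does not change under a deformation. -/
lemma classesIn_le_of_homotopy {S T : Set X} (H : X → ℝ → X)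
    (hH : ContinuousOn (Function.uncurry H) (S ×ˢ Set.Icc 0 1))
    (h0 : ∀ x ∈ S, H x 0 = x) (h1 : ∀ x ∈ S, H x 1 ∈ T) : classesIn S ≤ classesIn T := by
  classical
  let track (x : X) : PathChain X ⧸ boundaries X := if hx : x ∈ S then
    cls ⟨fun t : I ↦ H x t, by
      exact hH.comp_continuous (f := fun t : I ↦ (x, (t : ℝ))) (by fun_prop) fun t ↦ ⟨hx, t.2⟩⟩
    else 0
  have key {c : PathChain X} (hc : c ∈ chainsIn S) : ∃ c' ∈ chainsIn T,
      (boundaries X).mkQ c = (boundaries X).mkQ c' +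
        Finsupp.linearCombination (ZMod 2) track (boundary X c) ∧
      boundary X c' = Finsupp.lmapDomain (ZMod 2) (ZMod 2) (fun x ↦ H x 1) (boundary X c) := by
    refine chainsIn_induction (P := fun c ↦ ∃ c' ∈ chainsIn T,
      (boundaries X).mkQ c = (boundaries X).mkQ c' +
        Finsupp.linearCombination (ZMod 2) track (boundary X c) ∧
      boundary X c' = Finsupp.lmapDomain (ZMod 2) (ZMod 2) (fun x ↦ H x 1) (boundary X c))
      ⟨0, zero_mem _, by simp, by simp⟩ ?_ ?_ hc
    · rintro c d ⟨c', hc', hc1, hc2⟩ ⟨d', hd', hd1, hd2⟩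
      refine ⟨c' + d', add_mem hc' hd', ?_, ?_⟩
      · simp only [map_add, hc1, hd1]
        abel
      · simp only [map_add, hc2, hd2]
    · intro γ hγ
      let F : C(I × I, X) := ⟨fun p ↦ H (γ p.1) p.2,
        hH.comp_continuous (f := fun p : I × I ↦ (γ p.1, (p.2 : ℝ))) (by fun_prop)
          fun t ↦ ⟨hγ _, t.2.2⟩⟩
      have hF := cls_square F
      refine ⟨Finsupp.single (F.comp ⟨fun s ↦ (s, 1), by fun_prop⟩) 1,
        single_mem_chainsIn fun t ↦ ?_, ?_, ?_⟩
      · have : H (γ t) ((1 : I) : ℝ) ∈ T := by simpa using h1 _ (hγ t)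
        exact this
      · have e0 : F.comp ⟨fun s ↦ (s, 0), by fun_prop⟩ = γ := by
          ext t
          have : H (γ t) ((0 : I) : ℝ) = γ t := by simpa using h0 _ (hγ t)
          exact this
        rw [e0] at hF
        refine hF.trans ?_
        rw [boundary_single, map_add, Finsupp.linearCombination_single,
          Finsupp.linearCombination_single, one_smul, one_smul]
        simp only [track, hγ, dif_pos]
        rfl
      · rw [boundary_single, boundary_single, map_add]
        rw [Finsupp.lmapDomain_apply, Finsupp.lmapDomain_apply, Finsupp.mapDomain_single,
          Finsupp.mapDomain_single]
        have e (s : I) : F (s, 1) = H (γ s) 1 := congr_arg (H _) Set.Icc.coe_one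
        rw [← e, ← e]
        rfl
  rintro _ ⟨c, ⟨hc, hc0⟩, rfl⟩
  obtain ⟨c', hc', h2, h3⟩ := key hc
  rw [LinearMap.mem_ker.1 hc0, map_zero] at h2 h3
  exact ⟨c', ⟨hc', h3⟩, by rw [h2, add_zero]⟩

lemma exists_isCompact_chainsIn (c : PathChain X) :
    ∃ K : Set X, IsCompact K ∧ ∀ S, c ∈ chainsIn S ↔ K ⊆ S := by
  refine ⟨⋃ γ ∈ c.support, Set.range γ,
    c.support.isCompact_biUnion fun γ _ ↦ isCompact_range γ.continuous, fun S ↦ ?_⟩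
  simp only [chainsIn, Finsupp.mem_supported, Set.iUnion_subset_iff, Set.range_subset_iff]
  exact Iff.rfl

/-- Subdivision of a path subordinate to an open cover by two sets. -/
lemma exists_subdivision {A B : Set X} (hA : IsOpen A) (hB : IsOpen B) {c : PathChain X}
    (hc : c ∈ chainsIn (A ∪ B)) :
    ∃ a ∈ chainsIn A, ∃ b ∈ chainsIn B, c - (a + b) ∈ boundaries X := by
  suffices h : chainsIn (A ∪ B) ≤ chainsIn A ⊔ chainsIn B ⊔ boundaries X by
    obtain ⟨_, hab, r, hr, rfl⟩ := Submodule.mem_sup.1 (h hc)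
    obtain ⟨a, ha, b, hb, rfl⟩ := Submodule.mem_sup.1 hab
    exact ⟨a, ha, b, hb, by simpa using hr⟩
  intro c hc
  refine chainsIn_induction (P := fun c ↦ c ∈ chainsIn A ⊔ chainsIn B ⊔ boundaries X)
    (zero_mem _) (fun _ _ ↦ add_mem) (fun γ hγ ↦ ?_) hc
  let F : C(ℝ, X) := γ.comp ⟨Set.projIcc 0 1 zero_le_one, by fun_prop⟩
  obtain ⟨t, ht0, htm, ⟨n, hn⟩, ht⟩ := exists_monotone_Icc_subset_open_cover_unitInterval
    (c := fun i : Bool ↦ γ ⁻¹' (if i then A else B))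
    (fun i ↦ by cases i <;> simp [hA.preimage γ.continuous, hB.preimage γ.continuous])
    (fun s _ ↦ by
      rcases hγ s with h | h
      · exact Set.mem_iUnion.2 ⟨true, h⟩
      · exact Set.mem_iUnion.2 ⟨false, h⟩)
  have htri (u v w : ℝ) : Finsupp.single (seg F v w) 1 + Finsupp.single (seg F u w) 1 +
      Finsupp.single (seg F u v) (1 : ZMod 2) ∈ boundaries X :=
    (Submodule.Quotient.mk_eq_zero _).1 (cls_triangle F u v w)
  have hstep (k : ℕ) : Finsupp.single (seg F (t k) (t (k + 1))) 1 ∈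
      chainsIn A ⊔ chainsIn B ⊔ boundaries X := by
    obtain ⟨i, hi⟩ := ht k
    have hmem (s : I) : seg F (t k) (t (k + 1)) s ∈ if i then A else B := by
      have h1 : (t k : ℝ) ≤ t (k + 1) := htm k.le_succ
      have h2 : (1 - (s : ℝ)) • (t k : ℝ) + (s : ℝ) • (t (k + 1) : ℝ) ∈
          Set.Icc (t k : ℝ) (t (k + 1)) :=
        segment_eq_Icc h1 ▸ ⟨_, _, sub_nonneg.2 s.2.2, s.2.1, by ring, rfl⟩
      have h3 : (1 - (s : ℝ)) • (t k : ℝ) + (s : ℝ) • (t (k + 1) : ℝ) ∈ Set.Icc (0 : ℝ) 1 :=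
        ⟨(t k).2.1.trans h2.1, h2.2.trans (t (k + 1)).2.2⟩
      have h4 : seg F (t k) (t (k + 1)) s = γ ⟨_, h3⟩ :=
        congr_arg γ (Set.projIcc_of_mem zero_le_one h3)
      rw [h4]
      exact hi ⟨h2.1, h2.2⟩
    refine Submodule.mem_sup_left ?_
    cases i
    · exact Submodule.mem_sup_right (single_mem_chainsIn hmem)
    · exact Submodule.mem_sup_left (single_mem_chainsIn hmem)
  have hall (k : ℕ) : Finsupp.single (seg F 0 (t k)) 1 ∈
      chainsIn A ⊔ chainsIn B ⊔ boundaries X := by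
    induction k with
    | zero =>
      rw [ht0]
      refine Submodule.mem_sup_right ?_
      have : seg F 0 ((0 : I) : ℝ) = .const I (γ 0) := by ext; simp [seg, F]
      rw [this]
      exact (Submodule.Quotient.mk_eq_zero _).1 (cls_const (γ 0))
    | succ k ih =>
      have h := sub_mem (sub_mem (Submodule.mem_sup_right (htri 0 (t k) (t (k + 1)))) ih) (hstep k)
      simpa using h
  have h1 := hall n
  have : seg F 0 (t n) = γ := by ext s; simp [seg, F, hn n le_rfl]
  rwa [this] at h1

lemma rank_range_le_of_ker {K P M W : Type} [Field K] [AddCommGroup P] [Module K P]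
    [AddCommGroup M] [Module K M] [AddCommGroup W] [Module K W] (θ : P →ₗ[K] M) (ψ : P →ₗ[K] W)
    (N : Submodule K M) (h : ∀ p, ψ p = 0 → θ p ∈ N) :
    Module.rank K (LinearMap.range θ) ≤ Module.rank K N + Module.rank K W := by
  obtain ⟨Q, hQ⟩ := Submodule.exists_isCompl (LinearMap.ker ψ)
  have h1 : LinearMap.range θ ≤ N ⊔ Q.map θ := by
    rw [LinearMap.range_eq_map, ← hQ.sup_eq_top, Submodule.map_sup]
    refine sup_le_sup_right ?_ _
    rintro _ ⟨p, hp, rfl⟩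
    exact h p hp
  have h2 : Module.rank K Q ≤ Module.rank K W := by
    refine LinearMap.rank_le_of_injective (ψ ∘ₗ Q.subtype) ?_
    rw [← LinearMap.ker_eq_bot, LinearMap.ker_comp, ← Submodule.disjoint_iff_comap_eq_bot]
    exact hQ.symm.disjoint
  calc _ ≤ Module.rank K ↥(N ⊔ Q.map θ) := Submodule.rank_mono h1
    _ ≤ _ := Submodule.rank_add_le_rank_add_rank _ _
    _ ≤ _ := add_le_add_right ((rank_map_le θ Q).trans h2) _

lemma boundary_apply (c : PathChain X) : boundary X c =
    c.mapDomain (fun γ ↦ γ 0) + c.mapDomain (fun γ ↦ γ 1) := rfl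

lemma boundary_mem_supported {S : Set X} {c : PathChain X} (hc : c ∈ chainsIn S) :
    boundary X c ∈ Finsupp.supported (ZMod 2) (ZMod 2) S := by
  refine chainsIn_induction (P := fun c ↦ boundary X c ∈ Finsupp.supported (ZMod 2) (ZMod 2) S)
    ?_ ?_ ?_ hc
  · simp
  · intro c d hc hd
    rw [map_add]
    exact add_mem hc hd
  · intro γ hγ
    rw [boundary_single]
    exact add_mem (Finsupp.single_mem_supported _ _ (hγ 0)) (Finsupp.single_mem_supported _ _ (hγ 1))

lemma exists_boundary_eq {S T : Set X} {L : Type} (label : X → L)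
    (hl : ∀ x ∈ S, ∀ y ∈ S, label x = label y → JoinedIn T x y)
    {e : X →₀ ZMod 2} (he : e ∈ Finsupp.supported (ZMod 2) (ZMod 2) S)
    (he0 : e.mapDomain label = 0) : ∃ c ∈ chainsIn T, boundary X c = e := by
  classical
  by_cases hS : S = ∅
  · subst hS
    refine ⟨0, zero_mem _, ?_⟩
    simp at he
    rw [he, map_zero]
  obtain ⟨x0, hx0⟩ := Set.nonempty_iff_ne_empty.2 hS
  have : ∀ l : L, ∃ y, ∀ x ∈ S, label x = l → JoinedIn T x y := by
    intro l
    by_cases hl' : ∃ y ∈ S, label y = l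
    · obtain ⟨y, hy, rfl⟩ := hl'
      exact ⟨y, fun x hx h ↦ hl x hx y hy h⟩
    · exact ⟨x0, fun x hx h ↦ (hl' ⟨x, hx, h⟩).elim⟩
  choose rep hrep using this
  have : ∀ x, ∃ γ : C(I, X), x ∈ S → (∀ t, γ t ∈ T) ∧ γ 0 = x ∧ γ 1 = rep (label x) := by
    intro x
    by_cases hx : x ∈ S
    · have hj := hrep _ x hx rfl
      exact ⟨hj.somePath, fun _ ↦ ⟨hj.somePath_mem, by simp, by simp⟩⟩
    · exact ⟨.const I x, fun h ↦ (hx h).elim⟩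
  choose p hp using this
  have he' : ∀ x ∈ e.support, x ∈ S := fun x hx ↦ (Finsupp.mem_supported _ _).1 he hx
  refine ⟨e.mapDomain p, ?_, ?_⟩
  · intro γ hγ
    obtain ⟨x, hx, rfl⟩ := Finset.mem_image.1 (Finsupp.mapDomain_support hγ)
    exact (hp x (he' x hx)).1
  · rw [boundary_apply, ← Finsupp.mapDomain_comp, ← Finsupp.mapDomain_comp]
    have h0 : e.mapDomain ((fun γ : C(I, X) ↦ γ 0) ∘ p) = e :=
      (Finsupp.mapDomain_congr fun x hx ↦ (hp x (he' x hx)).2.1).trans Finsupp.mapDomain_id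
    have h1 : e.mapDomain ((fun γ : C(I, X) ↦ γ 1) ∘ p) = 0 := by
      refine (Finsupp.mapDomain_congr (g := rep ∘ label)
        fun x hx ↦ (hp x (he' x hx)).2.2).trans ?_
      rw [Finsupp.mapDomain_comp, he0, Finsupp.mapDomain_zero]
    rw [h0, h1, add_zero]

/-- Adding an open set `B` contained in an acyclic set `B'` creates at most as many new classes
as there are labels distinguishing the components of `A ∩ B` inside `A ∩ B'`. -/
theorem rank_classesIn_union_le {A B B' : Set X} (hA : IsOpen A) (hB : IsOpen B) (hBB' : B ⊆ B')
    (hB' : classesIn B' = ⊥) {L : Type} [Fintype L] (label : X → L)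
    (hl : ∀ x ∈ A ∩ B, ∀ y ∈ A ∩ B, label x = label y → JoinedIn (A ∩ B') x y) :
    Module.rank (ZMod 2) (classesIn (A ∪ B)) ≤
      Module.rank (ZMod 2) (classesIn A) + Fintype.card L := by
  let s : (PathChain X × PathChain X) →ₗ[ZMod 2] PathChain X :=
    LinearMap.coprod LinearMap.id LinearMap.id
  let P := (chainsIn A).prod (chainsIn B) ⊓ LinearMap.ker (boundary X ∘ₗ s)
  let θ : P →ₗ[ZMod 2] PathChain X ⧸ boundaries X := (boundaries X).mkQ ∘ₗ s ∘ₗ P.subtype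
  let ψ : P →ₗ[ZMod 2] (L →₀ ZMod 2) := Finsupp.lmapDomain (ZMod 2) (ZMod 2) label ∘ₗ
    boundary X ∘ₗ LinearMap.fst _ _ _ ∘ₗ P.subtype
  have h1 : classesIn (A ∪ B) ≤ LinearMap.range θ := by
    rintro _ ⟨c, ⟨hc, hc0⟩, rfl⟩
    obtain ⟨a, ha, b, hb, hab⟩ := exists_subdivision hA hB hc
    refine ⟨⟨(a, b), ⟨ha, hb⟩, ?_⟩, ?_⟩
    · have h := LinearMap.mem_ker.1 (boundaries_le_ker hab)
      rw [map_sub, sub_eq_zero, LinearMap.mem_ker.1 hc0] at h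
      exact h.symm
    · exact ((Submodule.Quotient.eq _).2 hab).symm
  have h2 : ∀ p, ψ p = 0 → θ p ∈ classesIn A := by
    rintro ⟨⟨a, b⟩, ⟨⟨ha, hb⟩, hp⟩⟩ h0
    have hab : boundary X a + boundary X b = 0 := by
      rw [← map_add]
      exact hp
    have hab' : boundary X a = boundary X b := by
      rw [eq_neg_of_add_eq_zero_left hab, ZModModule.neg_eq_self]
    have he : boundary X a ∈ Finsupp.supported (ZMod 2) (ZMod 2) (A ∩ B) := by
      intro x hx
      exact ⟨boundary_mem_supported ha hx, boundary_mem_supported hb (hab' ▸ hx)⟩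
    obtain ⟨c, hc, hca⟩ := exists_boundary_eq label hl he h0
    have hbc : (boundaries X).mkQ (b + c) ∈ classesIn B' := by
      refine ⟨b + c, ⟨add_mem (chainsIn_mono hBB' hb)
        (chainsIn_mono Set.inter_subset_right hc), ?_⟩, rfl⟩
      rw [SetLike.mem_coe, LinearMap.mem_ker, map_add, hca, hab', ZModModule.add_self]
    rw [hB', Submodule.mem_bot] at hbc
    refine ⟨a + c, ⟨add_mem ha (chainsIn_mono Set.inter_subset_left hc), ?_⟩, ?_⟩
    · rw [SetLike.mem_coe, LinearMap.mem_ker, map_add, hca, ZModModule.add_self]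
    · change _ = (boundaries X).mkQ (a + b)
      rw [map_add] at hbc ⊢
      rw [map_add, eq_neg_of_add_eq_zero_left hbc, ZModModule.neg_eq_self]
  have h3 := rank_range_le_of_ker (K := ZMod 2) (P := P) (M := PathChain X ⧸ boundaries X)
    (W := L →₀ ZMod 2) θ ψ (classesIn A) h2
  rw [rank_finsupp_self', Cardinal.mk_fintype] at h3
  exact (Submodule.rank_mono h1).trans h3

end PathChain

section MorseLocal

variable {ι : Type} [Fintype ι]

/-- Rescaling of the positive and negative parts of a vector with respect to a signature. -/
noncomputable def signScale (w y : ι → ℝ) (α β : ℝ) : ι → ℝ :=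
  fun i ↦ if w i = 1 then α * y i else β * y i

lemma norm_signScale_le (w y : ι → ℝ) {α β c : ℝ} (hα : |α| ≤ c) (hβ : |β| ≤ c) :
    ‖signScale w y α β‖ ≤ c * ‖y‖ := by
  have hc := (abs_nonneg α).trans hα
  refine (pi_norm_le_iff_of_nonneg (by positivity)).2 fun i ↦ ?_
  have hi := norm_le_pi_norm y i
  unfold signScale
  split_ifs <;> rw [norm_mul] <;> exact mul_le_mul ‹_› hi (norm_nonneg _) hc

lemma norm_sq_le_sum (y : ι → ℝ) : ‖y‖ ^ 2 ≤ ∑ i, y i ^ 2 := by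
  have h : ‖y‖ ≤ √(∑ i, y i ^ 2) := (pi_norm_le_iff_of_nonneg (by positivity)).2 fun i ↦
    Real.abs_le_sqrt (Finset.single_le_sum (f := fun i ↦ y i ^ 2) (fun _ _ ↦ sq_nonneg _) (Finset.mem_univ i))
  exact (Real.le_sqrt (norm_nonneg _) (by positivity)).1 h

/-- Near a nondegenerate critical point, a positive point may be joined to a coordinate half-axis
of positive sign, inside the positivity set. -/
lemma joinedIn_pos_of_quadratic (h : (ι → ℝ) → ℝ) (w : ι → ℝ) (hw : ∀ i, w i = -1 ∨ w i = 1)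
    (h0 : h 0 = 0) {δ : ℝ}
    (he : ∀ ρ ≤ δ, ∀ a b, ‖a‖ ≤ ρ → ‖b‖ ≤ ρ →
      |(h a - ∑ i, w i * a i ^ 2) - (h b - ∑ i, w i * b i ^ 2)| ≤ ρ / 10 * ‖a - b‖)
    {R : ℝ} (hR : R ≤ δ) {y : ι → ℝ} (hy : 2 * ‖y‖ < R) (hpos : 0 < h y) :
    ∃ i, w i = 1 ∧ y i ≠ 0 ∧ ∀ s : ℝ, 0 < s * y i → |s| < R → ∀ z : ι → ℝ, z i = s →
      (∀ j, j ≠ i → z j = 0) → JoinedIn ({x | 0 < h x} ∩ Metric.ball 0 R) y z := by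
  set P := ∑ i, if w i = 1 then y i ^ 2 else 0 with hP
  set N := ∑ i, if w i = 1 then 0 else y i ^ 2 with hN
  have hQ (α β : ℝ) : ∑ i, w i * signScale w y α β i ^ 2 = α ^ 2 * P - β ^ 2 * N := by
    rw [hP, hN, Finset.mul_sum, Finset.mul_sum, ← Finset.sum_sub_distrib]
    refine Finset.sum_congr rfl fun i _ ↦ ?_
    unfold signScale
    split_ifs with hi
    · rw [hi]; ring
    · rw [(hw i).resolve_right hi]; ring
  have h11 : signScale w y 1 1 = y := by ext i; simp [signScale]
  have hy2 : ‖y‖ ^ 2 ≤ P + N := by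
    refine (norm_sq_le_sum y).trans_eq ?_
    rw [hP, hN, ← Finset.sum_add_distrib]
    exact Finset.sum_congr rfl fun i _ ↦ by split_ifs <;> simp
  have hP0 : 0 ≤ P := Finset.sum_nonneg fun i _ ↦ by positivity
  have hN0 : 0 ≤ N := Finset.sum_nonneg fun i _ ↦ by positivity
  have he0 (z : ι → ℝ) (hz : ‖z‖ ≤ δ) : |h z - ∑ i, w i * z i ^ 2| ≤ ‖z‖ ^ 2 / 10 := by
    have := he ‖z‖ hz z 0 le_rfl (by simp)
    simp only [h0, Pi.zero_apply, sub_zero] at this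
    simp at this
    linarith
  have hQy := hQ 1 1
  rw [h11] at hQy
  have hyδ : ‖y‖ ≤ δ := by linarith [norm_nonneg y]
  have hNP : N ≤ 2 * P := by
    have := (abs_le.1 (he0 y hyδ)).2
    nlinarith
  have hPpos : 0 < P := by
    by_contra! hP'
    have := (abs_le.1 (he0 y hyδ)).2
    nlinarith
  obtain ⟨i, -, hi⟩ := Finset.exists_lt_of_sum_lt (s := Finset.univ) (f := fun _ : ι ↦ (0 : ℝ))
    (g := fun i ↦ if w i = 1 then y i ^ 2 else 0) (by simpa using hPpos)
  have hwi : w i = 1 := by by_contra hc; simp [hc] at hi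
  have hyi : y i ≠ 0 := by rintro hc; simp [hc] at hi
  refine ⟨i, hwi, hyi, fun s hs hsR z hz hz' ↦ ?_⟩
  have hball {α β : ℝ} (hα : |α| ≤ 2) (hβ : |β| ≤ 2) : ‖signScale w y α β‖ < R :=
    (norm_signScale_le w y hα hβ).trans_lt hy
  have s1 : JoinedIn ({x | 0 < h x} ∩ Metric.ball 0 R) y (signScale w y 2 1) := by
    refine JoinedIn.of_segment_subset ?_
    rw [segment_eq_image']
    rintro _ ⟨l, ⟨hl0, hl1⟩, rfl⟩
    have e1 : y + l • (signScale w y 2 1 - y) = signScale w y (1 + l) 1 := by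
      ext j
      simp only [signScale, Pi.add_apply, Pi.smul_apply, Pi.sub_apply, smul_eq_mul]
      split_ifs <;> ring
    simp only [e1]
    have e2 : signScale w y (1 + l) 1 - y = signScale w y l 0 := by
      ext j
      simp only [signScale, Pi.sub_apply]
      split_ifs <;> ring
    refine ⟨?_, mem_ball_zero_iff.2 (hball (abs_le.2 ⟨by linarith, by linarith⟩) (by norm_num))⟩
    have h1 := he (2 * ‖y‖) (by linarith) (signScale w y (1 + l) 1) y
      (norm_signScale_le w y (abs_le.2 ⟨by linarith, by linarith⟩) (by norm_num))
      (by linarith [norm_nonneg y])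
    have h2 : ‖signScale w y l 0‖ ≤ l * ‖y‖ :=
      norm_signScale_le w y (by rw [abs_of_nonneg hl0]) (by simpa using hl0)
    rw [hQ, hQy, e2] at h1
    have h3 : 2 * ‖y‖ / 10 * ‖signScale w y l 0‖ ≤ 2 * ‖y‖ / 10 * (l * ‖y‖) := by gcongr
    have h4 := (abs_le.1 h1).1
    have h5 : 0 ≤ l * (P + N - ‖y‖ ^ 2) := mul_nonneg hl0 (by linarith)
    have h6 : 0 ≤ l * (2 * P - N) := mul_nonneg hl0 (by linarith)
    have h7 : 0 ≤ l * P := by positivity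
    have h8 : 0 ≤ l ^ 2 * P := by positivity
    change 0 < h _
    nlinarith
  have s2 : JoinedIn ({x | 0 < h x} ∩ Metric.ball 0 R) (signScale w y 2 1)
      (signScale w y 2 0) := by
    refine JoinedIn.of_segment_subset ?_
    rw [segment_eq_image']
    rintro _ ⟨l, ⟨hl0, hl1⟩, rfl⟩
    have e1 : signScale w y 2 1 + l • (signScale w y 2 0 - signScale w y 2 1) =
        signScale w y 2 (1 - l) := by
      ext j
      simp only [signScale, Pi.add_apply, Pi.smul_apply, Pi.sub_apply, smul_eq_mul]
      split_ifs <;> ring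
    simp only [e1]
    have hb : ‖signScale w y 2 (1 - l)‖ < R :=
      hball (by norm_num) (abs_le.2 ⟨by linarith, by linarith⟩)
    refine ⟨?_, mem_ball_zero_iff.2 hb⟩
    have h1 := he0 _ (hb.le.trans hR)
    have h2 : ‖signScale w y 2 (1 - l)‖ ≤ 2 * ‖y‖ :=
      norm_signScale_le w y (by norm_num) (abs_le.2 ⟨by linarith, by linarith⟩)
    rw [hQ] at h1
    have h3 : ‖signScale w y 2 (1 - l)‖ ^ 2 ≤ (2 * ‖y‖) ^ 2 := by gcongr
    have h4 := (abs_le.1 h1).1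
    have h5 : (1 - l) ^ 2 * N ≤ 1 * N := by gcongr; nlinarith
    change 0 < h _
    nlinarith
  have s3 : JoinedIn ({x | 0 < h x} ∩ Metric.ball 0 R) (signScale w y 2 0) z := by
    refine JoinedIn.of_segment_subset fun u hu ↦ ?_
    have hzR : ‖z‖ < R := by
      refine (pi_norm_lt_iff ((abs_nonneg s).trans_lt hsR)).2 fun j ↦ ?_
      by_cases hj : j = i
      · rw [hj, hz]; exact hsR
      · rw [hz' j hj, norm_zero]; exact (abs_nonneg s).trans_lt hsR
    have huR : u ∈ Metric.ball (0 : ι → ℝ) R := (convex_ball 0 R).segment_subset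
      (mem_ball_zero_iff.2 (hball (by norm_num) (by norm_num))) (mem_ball_zero_iff.2 hzR) hu
    refine ⟨?_, huR⟩
    have h1 := (abs_le.1 (he0 u ((mem_ball_zero_iff.1 huR).le.trans hR))).1
    have h2 := norm_sq_le_sum u
    obtain ⟨a, b, ha, hb, hab, rfl⟩ := hu
    set u := a • signScale w y 2 0 + b • z
    have hu0 (j : ι) (hj : w j ≠ 1) : u j = 0 := by
      have : j ≠ i := by rintro rfl; exact hj hwi
      simp [u, signScale, hj, hz' j this]
    have h3 : ∑ j, w j * u j ^ 2 = ∑ j, u j ^ 2 := by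
      refine Finset.sum_congr rfl fun j _ ↦ ?_
      by_cases hj : w j = 1
      · rw [hj, one_mul]
      · rw [hu0 j hj]; ring
    have h4 : 0 < u i ^ 2 := by
      have h6 : u i = a * (2 * y i) + b * s := by simp [u, signScale, hwi, hz]
      have h7 : 0 < y i ^ 2 := by positivity
      have h8 : 0 < u i * y i := by
        rw [h6]
        rcases ha.eq_or_lt with rfl | ha
        · obtain rfl : b = 1 := by linarith
          linarith
        · have := mul_nonneg hb hs.le
          nlinarith [mul_pos ha h7]
      have : u i ≠ 0 := fun hc ↦ by simp [hc] at h8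
      positivity
    have h5 : u i ^ 2 ≤ ∑ j, u j ^ 2 :=
      Finset.single_le_sum (f := fun i ↦ u i ^ 2) (fun _ _ ↦ sq_nonneg _) (Finset.mem_univ i)
    change 0 < h _
    linarith
  exact (s1.trans s2).trans s3

variable {E : Type} [NormedAddCommGroup E] [NormedSpace ℝ E]

lemma exists_remainder_bound {g : E → ℝ} (hg : ContDiff ℝ 2 g) {p : E} (hp : fderiv ℝ g p = 0)
    {ε : ℝ} (hε : 0 < ε) : ∃ δ > 0, ∀ ρ ≤ δ, ∀ a b, ‖a‖ ≤ ρ → ‖b‖ ≤ ρ →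
      |(g (p + a) - 2⁻¹ * fderiv ℝ (fderiv ℝ g) p a a) -
        (g (p + b) - 2⁻¹ * fderiv ℝ (fderiv ℝ g) p b b)| ≤ ε * ρ * ‖a - b‖ := by
  set B := fderiv ℝ (fderiv ℝ g) p with hB
  have hsymm : ∀ v w, B v w = B w v := fun v w ↦
    (hg.contDiffAt.isSymmSndFDerivAt (by simp)).eq v w
  have hd : HasFDerivAt (fderiv ℝ g) B p :=
    ((hg.fderiv_right (m := 1) (by norm_num)).differentiable one_ne_zero p).hasFDerivAt
  rw [hasFDerivAt_iff_isLittleO_nhds_zero] at hd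
  obtain ⟨δ, hδ, hb⟩ := Metric.eventually_nhds_iff_ball.1 (hd.bound hε)
  refine ⟨δ / 2, by positivity, fun ρ hρ a b ha hb' ↦ ?_⟩
  have he (v : E) : HasFDerivAt (fun v ↦ g (p + v) - 2⁻¹ * B v v) (fderiv ℝ g (p + v) - B v) v := by
    have h1 : HasFDerivAt (fun v ↦ g (p + v)) (fderiv ℝ g (p + v)) v := by
      have := ((hg.differentiable two_ne_zero (p + v)).hasFDerivAt).comp v
        ((hasFDerivAt_id v).const_add p)
      exact this.congr_fderiv (ContinuousLinearMap.comp_id _)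
    have h2 : HasFDerivAt (fun v ↦ 2⁻¹ * B v v) (B v) v := by
      have := ((B.hasFDerivAt (x := v)).clm_apply (hasFDerivAt_id v)).const_mul 2⁻¹
      refine this.congr_fderiv ?_
      ext w
      simp [hsymm w v]
      ring
    exact h1.sub h2
  have := (convex_closedBall (0 : E) ρ).norm_image_sub_le_of_norm_hasFDerivWithin_le
    (C := ε * ρ) (fun x _ ↦ (he x).hasFDerivWithinAt) (fun x hx ↦ ?_)
    (mem_closedBall_zero_iff.2 hb') (mem_closedBall_zero_iff.2 ha)
  · simpa using this
  · have hx' := mem_closedBall_zero_iff.1 hx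
    have := hb x (mem_ball_zero_iff.2 (by linarith))
    rw [hp, sub_zero] at this
    exact this.trans (by gcongr)

/-- Near a nondegenerate critical point, the superlevel set has boundedly many components. -/
theorem exists_label_of_nondegenerate [FiniteDimensional ℝ E] [Nontrivial E] {g : E → ℝ}
    (hg : ContDiff ℝ 2 g) {p : E} (hp : fderiv ℝ g p = 0)
    (hnd : ∀ v, fderiv ℝ (fderiv ℝ g) p v = 0 → v = 0) {R : ℝ} (hR : 0 < R) :
    ∃ r > 0, r ≤ R ∧ ∃ label : E → Fin (Module.finrank ℝ E) × Bool,
      ∀ x ∈ Metric.ball p r, ∀ y ∈ Metric.ball p r, g p < g x → g p < g y → label x = label y →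
        JoinedIn ({x | g p < g x} ∩ Metric.ball p R) x y := by
  classical
  set B := fderiv ℝ (fderiv ℝ g) p with hB
  have hsymm : ∀ v w, B v w = B w v := fun v w ↦
    (hg.contDiffAt.isSymmSndFDerivAt (by simp)).eq v w
  let B' : LinearMap.BilinForm ℝ E := ((2 : ℝ)⁻¹ • B).toBilinForm
  have hB' (v w : E) : B' v w = 2⁻¹ * B v w := rfl
  let Q : QuadraticForm ℝ E := B'.toQuadraticMap
  have hQ : (QuadraticMap.associated (R := ℝ) Q) = B' :=
    QuadraticMap.associated_left_inverse _ fun x y ↦ by rw [hB', hB', hsymm]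
  obtain ⟨w, hw, ⟨Φ⟩⟩ := Q.equivalent_one_neg_one_weighted_sum_squared (by
    rw [hQ]
    intro v hv
    refine hnd v ?_
    ext u
    simpa [hB'] using hv u)
  let Ψ := Φ.toLinearEquiv.symm.toContinuousLinearEquiv
  have hΨ (y) : ∑ i, w i * y i ^ 2 = 2⁻¹ * B (Ψ y) (Ψ y) := by
    have h := Φ.map_app (Ψ y)
    have h' : Φ (Ψ y) = y := Φ.toLinearEquiv.apply_symm_apply y
    rw [h', QuadraticMap.weightedSumSquares_apply] at h
    have h'' : Q (Ψ y) = 2⁻¹ * B (Ψ y) (Ψ y) := rfl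
    rw [← h'', ← h]
    simp [pow_two]
  set K := ‖(Ψ : (Fin (Module.finrank ℝ E) → ℝ) →L[ℝ] E)‖ + 1
  have hK : 0 < K := by positivity
  have hΨK (y) : ‖Ψ y‖ ≤ K * ‖y‖ :=
    ((Ψ : (Fin (Module.finrank ℝ E) → ℝ) →L[ℝ] E).le_opNorm y).trans
      (by gcongr; simp [K])
  obtain ⟨δ, hδ, he⟩ := exists_remainder_bound hg hp (ε := 1 / (10 * K ^ 2)) (by positivity)
  let h : (Fin (Module.finrank ℝ E) → ℝ) → ℝ := fun y ↦ g (p + Ψ y) - g p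
  set R' := min (δ / K) (R / K) with hR'
  have hR'0 : 0 < R' := by positivity
  have he' : ∀ ρ ≤ δ / K, ∀ a b, ‖a‖ ≤ ρ → ‖b‖ ≤ ρ →
      |(h a - ∑ i, w i * a i ^ 2) - (h b - ∑ i, w i * b i ^ 2)| ≤ ρ / 10 * ‖a - b‖ := by
    intro ρ hρ a b ha hb
    have h1 := he (K * ρ) (by rwa [le_div_iff₀' hK] at hρ) (Ψ a) (Ψ b)
      ((hΨK a).trans (by gcongr)) ((hΨK b).trans (by gcongr))
    rw [hΨ, hΨ]
    have h2 : ‖Ψ a - Ψ b‖ ≤ K * ‖a - b‖ := by rw [← map_sub]; exact hΨK _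
    have hρ0 : 0 ≤ ρ := (norm_nonneg _).trans ha
    calc _ = |(g (p + Ψ a) - 2⁻¹ * B (Ψ a) (Ψ a)) - (g (p + Ψ b) - 2⁻¹ * B (Ψ b) (Ψ b))| := by
          congr 1; simp only [h]; ring
      _ ≤ _ := h1
      _ ≤ 1 / (10 * K ^ 2) * (K * ρ) * (K * ‖a - b‖) := by gcongr
      _ = _ := by field_simp
  have : NeZero (Module.finrank ℝ E) := ⟨Module.finrank_pos.ne'⟩
  let target (l : Fin (Module.finrank ℝ E) × Bool) : Fin (Module.finrank ℝ E) → ℝ :=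
    Pi.single l.1 (if l.2 then R' / 2 else -(R' / 2))
  have hlab (y : Fin (Module.finrank ℝ E) → ℝ) : ∃ l : Fin (Module.finrank ℝ E) × Bool,
      2 * ‖y‖ < R' → 0 < h y → JoinedIn ({x | 0 < h x} ∩ Metric.ball 0 R') y (target l) := by
    by_cases hy : 2 * ‖y‖ < R' ∧ 0 < h y
    · obtain ⟨i, -, hi, hj⟩ := joinedIn_pos_of_quadratic h w hw (by simp [h]) he'
        (min_le_left _ _) hy.1 hy.2
      refine ⟨(i, decide (0 < y i)), fun _ _ ↦ hj (if 0 < y i then R' / 2 else -(R' / 2)) ?_ ?_ _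
        (by simp [target]) fun j hj ↦ by simp [target, hj]⟩
      · split_ifs with h
        · positivity
        · exact mul_pos_of_neg_of_neg (by linarith) (lt_of_le_of_ne (not_lt.1 h) hi)
      · split_ifs
        · rw [abs_of_pos] <;> linarith
        · rw [abs_neg, abs_of_pos] <;> linarith
    · exact ⟨(0, true), fun h1 h2 ↦ (hy ⟨h1, h2⟩).elim⟩
  choose lab hlab using hlab
  have hnhds : ∀ᶠ x in nhds p, 2 * ‖Ψ.symm (x - p)‖ < R' := by
    have : ContinuousAt (fun x ↦ 2 * ‖Ψ.symm (x - p)‖) p := by fun_prop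
    exact this.eventually_lt_const (by simpa using hR'0)
  obtain ⟨r, hr, hball⟩ := Metric.eventually_nhds_iff_ball.1 hnhds
  have key (x) (hx : x ∈ Metric.ball p (min r R)) (hgx : g p < g x) :
      JoinedIn ({x | g p < g x} ∩ Metric.ball p R) x (p + Ψ (target (lab (Ψ.symm (x - p))))) := by
    have hj := hlab (Ψ.symm (x - p)) (hball x (Metric.ball_subset_ball (min_le_left _ _) hx))
      (by simpa [h] using hgx)
    have hj' := hj.map_continuousOn (f := fun y ↦ p + Ψ y) (by fun_prop)
    simp only [ContinuousLinearEquiv.apply_symm_apply, add_sub_cancel] at hj'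
    refine hj'.mono ?_
    rintro _ ⟨y, ⟨hy1, hy2⟩, rfl⟩
    refine ⟨sub_pos.1 (show 0 < g (p + Ψ y) - g p from hy1), ?_⟩
    rw [mem_ball_zero_iff] at hy2
    rw [Metric.mem_ball, dist_self_add_left]
    refine (hΨK y).trans_lt ?_
    have := hy2.trans_le (min_le_right _ _)
    rwa [lt_div_iff₀' hK] at this
  refine ⟨min r R, by positivity, min_le_right _ _, fun x ↦ lab (Ψ.symm (x - p)),
    fun x hx y hy hgx hgy hxy ↦ ?_⟩
  have h1 := key x hx hgx
  rw [show lab (Ψ.symm (x - p)) = lab (Ψ.symm (y - p)) from hxy] at h1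
  exact h1.trans (key y hy hgy).symm

end MorseLocal

namespace PathChain

open unitInterval

lemma rank_le_of_forall_finset {K M : Type} [Field K] [AddCommGroup M] [Module K M]
    {N : Submodule K M} {n : ℕ}
    (h : ∀ S : Finset M, (S : Set M) ⊆ N → ∃ N' : Submodule K M, Module.rank K N' ≤ n ∧
      (S : Set M) ⊆ N') : Module.rank K N ≤ n := by
  classical
  refine rank_le fun S hS ↦ ?_
  obtain ⟨N', hN', hS'⟩ := h (S.map (Function.Embedding.subtype _)) (by
    intro x hx
    obtain ⟨y, -, rfl⟩ := Finset.mem_map.1 (Finset.mem_coe.1 hx)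
    exact y.2)
  have hmem (x : S) : (x : M) ∈ N' :=
    hS' (Finset.mem_coe.2 (Finset.mem_map.2 ⟨x, x.2, rfl⟩))
  have h1 : LinearIndependent K (fun x : S ↦ ((x : N) : M)) :=
    hS.map' N.subtype (Submodule.ker_subtype N)
  have h2 : LinearIndependent K (fun x : S ↦ (⟨(x : N), hmem x⟩ : N')) :=
    LinearIndependent.of_comp N'.subtype h1
  have h3 := h2.cardinal_le_rank.trans hN'
  simpa using h3

section

variable {X : Type} [TopologicalSpace X]

lemma exists_isCompact_classesIn {T : Set X} (S : Finset (PathChain X ⧸ boundaries X))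
    (hS : (S : Set (PathChain X ⧸ boundaries X)) ⊆ classesIn T) :
    ∃ K ⊆ T, IsCompact K ∧ (S : Set (PathChain X ⧸ boundaries X)) ⊆ classesIn K := by
  classical
  induction S using Finset.induction_on with
  | empty => exact ⟨∅, Set.empty_subset _, isCompact_empty, by simp⟩
  | insert a S _ ih =>
    rw [Finset.coe_insert, Set.insert_subset_iff] at hS
    obtain ⟨K, hK, hKc, hSK⟩ := ih hS.2
    obtain ⟨c, ⟨hc, hc0⟩, hca⟩ := hS.1
    obtain ⟨K', hK', hcK'⟩ := exists_isCompact_chainsIn c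
    refine ⟨K' ∪ K, Set.union_subset ((hcK' T).1 hc) hK, hK'.union hKc, ?_⟩
    rw [Finset.coe_insert, Set.insert_subset_iff]
    refine ⟨⟨c, ⟨(hcK' _).2 Set.subset_union_left, hc0⟩, hca⟩, ?_⟩
    exact hSK.trans (classesIn_mono Set.subset_union_right)

end

variable {E : Type} [TopologicalSpace E]

/-- The degree-one classes of a subspace `U` represented by cycles carried by `S`. -/
noncomputable def classesOn (U S : Set E) : Submodule (ZMod 2) (PathChain U ⧸ boundaries U) :=
  classesIn ((↑) ⁻¹' S)

lemma classesOn_mono {U S T : Set E} (h : S ⊆ T) : classesOn U S ≤ classesOn U T :=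
  classesIn_mono (Set.preimage_mono h)

lemma classesOn_empty (U : Set E) : classesOn U ∅ = ⊥ := by
  rw [eq_bot_iff]
  rintro _ ⟨c, ⟨hc, -⟩, rfl⟩
  have : c = 0 := by
    simpa [chainsIn] using hc
  simp [this]

lemma exists_lift_homotopy {U S : Set E} (H : E → ℝ → E)
    (hH : ContinuousOn (Function.uncurry H) (S ×ˢ Set.Icc 0 1))
    (hU : ∀ x ∈ S, ∀ s ∈ Set.Icc (0 : ℝ) 1, H x s ∈ U) :
    ∃ H' : U → ℝ → U, ContinuousOn (Function.uncurry H') (((↑) ⁻¹' S) ×ˢ Set.Icc 0 1) ∧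
      ∀ x : U, (x : E) ∈ S → ∀ s ∈ Set.Icc (0 : ℝ) 1, (H' x s : E) = H x s := by
  classical
  refine ⟨fun x s ↦ if h : H x s ∈ U then ⟨H x s, h⟩ else x, ?_, ?_⟩
  · rw [Topology.IsInducing.subtypeVal.continuousOn_iff]
    have h1 : ContinuousOn (fun p : U × ℝ ↦ H p.1 p.2) (((↑) ⁻¹' S) ×ˢ Set.Icc 0 1) :=
      hH.comp (f := fun p : U × ℝ ↦ ((p.1 : E), p.2)) (by fun_prop) fun p hp ↦ hp
    refine h1.congr fun p hp ↦ ?_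
    simp only [Function.comp, Function.uncurry]
    rw [dif_pos (hU _ hp.1 _ hp.2)]
  · intro x hx s hs
    simp only
    rw [dif_pos (hU _ hx _ hs)]

lemma classesOn_le_of_homotopy {U S T : Set E} (H : E → ℝ → E)
    (hH : ContinuousOn (Function.uncurry H) (S ×ˢ Set.Icc 0 1))
    (hU : ∀ x ∈ S, ∀ s ∈ Set.Icc (0 : ℝ) 1, H x s ∈ U)
    (h0 : ∀ x ∈ S, H x 0 = x) (h1 : ∀ x ∈ S, H x 1 ∈ T) : classesOn U S ≤ classesOn U T := by
  obtain ⟨H', hc, hH'⟩ := exists_lift_homotopy H hH hU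
  refine classesIn_le_of_homotopy H' hc (fun x hx ↦ Subtype.ext ?_) fun x hx ↦ ?_
  · rw [hH' x hx 0 (by simp), h0 x hx]
  · rw [Set.mem_preimage, hH' x hx 1 (by simp)]
    exact h1 x hx

lemma joinedIn_preimage {U S : Set E} (hS : S ⊆ U) {x y : U} (h : JoinedIn S (x : E) y) :
    JoinedIn ((↑) ⁻¹' S : Set U) x y := by
  obtain ⟨γ, hγ⟩ := h
  refine ⟨⟨⟨fun t ↦ ⟨γ t, hS (hγ t)⟩, by fun_prop⟩, ?_, ?_⟩, fun t ↦ hγ t⟩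
  · exact Subtype.ext γ.source
  · exact Subtype.ext γ.target

section

variable {E : Type} [NormedAddCommGroup E] [NormedSpace ℝ E]

lemma classesOn_convex {U S : Set E} (hS : Convex ℝ S) (hSU : S ⊆ U) : classesOn U S = ⊥ := by
  rcases S.eq_empty_or_nonempty with rfl | ⟨p, hp⟩
  · exact classesOn_empty U
  · have h := classesOn_le_of_homotopy (U := U) (S := S) (T := {p})
      (fun x s ↦ x + s • (p - x)) (by fun_prop)
      (fun x hx s hs ↦ hSU (hS.add_smul_sub_mem hx hp hs)) (by simp) (by simp)
    rw [eq_bot_iff]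
    refine h.trans ?_
    have : ((↑) ⁻¹' {p} : Set U) = {⟨p, hSU hp⟩} := by ext; simp [Subtype.ext_iff]
    rw [classesOn, this, classesIn_singleton]

lemma rank_classesOn_union_le {U A B B' : Set E} (hA : IsOpen A) (hB : IsOpen B) (hBB' : B ⊆ B')
    (hB' : Convex ℝ B') (hU : B' ⊆ U) {L : Type} [Fintype L] (label : E → L)
    (hl : ∀ x ∈ A ∩ B, ∀ y ∈ A ∩ B, label x = label y → JoinedIn (A ∩ B') x y) :
    Module.rank (ZMod 2) (classesOn U (A ∪ B)) ≤
      Module.rank (ZMod 2) (classesOn U A) + Fintype.card L := by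
  have h := rank_classesIn_union_le (X := U) (hA.preimage continuous_subtype_val)
    (hB.preimage continuous_subtype_val) (Set.preimage_mono hBB') (classesOn_convex hB' hU)
    (fun x ↦ label x)
    fun x hx y hy hxy ↦ joinedIn_preimage (Set.inter_subset_right.trans hU) (hl x hx y hy hxy)
  rw [← Set.preimage_union] at h
  exact h

end

end PathChain

section MorseFlow

open Filter Topology

variable {E : Type} [NormedAddCommGroup E] [NormedSpace ℝ E]

lemma eventually_lt_along_field {g : E → ℝ} (hg : ContDiff ℝ 2 g) {G : E → E} (hG : Continuous G)
    {x : E} (hx : 0 < fderiv ℝ g x (G x)) :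
    ∀ᶠ z : E × ℝ in 𝓝 x ×ˢ 𝓝[>] 0, g z.1 < g (z.1 + z.2 • G z.1) := by
  have hs : HasStrictFDerivAt g (fderiv ℝ g x) x :=
    hg.contDiffAt.hasStrictFDerivAt two_ne_zero
  set c := fderiv ℝ g x (G x)
  set ε := c / (4 * (‖G x‖ + 1))
  have hε : 0 < ε := by positivity
  have hlim : Tendsto (fun z : E × ℝ ↦ (z.1 + z.2 • G z.1, z.1)) (𝓝 x ×ˢ 𝓝[>] 0) (𝓝 (x, x)) := by
    have : ContinuousAt (fun z : E × ℝ ↦ (z.1 + z.2 • G z.1, z.1)) (x, 0) := by fun_prop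
    have h2 := this.tendsto.mono_left (nhds_prod_eq.trans_ge
      (Filter.prod_mono le_rfl (nhdsWithin_le_nhds (s := Set.Ioi 0))))
    simpa using h2
  have h1 := hlim.eventually (hs.isLittleO.bound hε)
  have h2 : ∀ᶠ z : E × ℝ in 𝓝 x ×ˢ 𝓝[>] 0, c / 2 < fderiv ℝ g x (G z.1) := by
    have : ContinuousAt (fun z : E ↦ fderiv ℝ g x (G z)) x := by fun_prop
    exact (this.eventually_const_lt (half_lt_self hx)).prod_inl _
  have h3 : ∀ᶠ z : E × ℝ in 𝓝 x ×ˢ 𝓝[>] 0, ‖G z.1‖ < ‖G x‖ + 1 := by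
    have : ContinuousAt (fun z : E ↦ ‖G z‖) x := by fun_prop
    exact (this.eventually_lt_const (lt_add_one _)).prod_inl _
  have h4 : ∀ᶠ z : E × ℝ in 𝓝 x ×ˢ 𝓝[>] 0, 0 < z.2 :=
    (eventually_mem_nhdsWithin (a := (0 : ℝ)) (s := Set.Ioi 0)).prod_inr _
  filter_upwards [h1, h2, h3, h4] with z hz1 hz2 hz3 hz4
  simp only [add_sub_cancel_left, map_smul, smul_eq_mul, norm_smul, Real.norm_eq_abs,
    abs_of_pos hz4] at hz1
  have h5 := (abs_le.1 hz1).1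
  have h6 : ε * (z.2 * ‖G z.1‖) ≤ ε * (z.2 * (‖G x‖ + 1)) := by gcongr
  have h7 : ε * (z.2 * (‖G x‖ + 1)) = z.2 * (c / 4) := by
    simp only [ε]; field_simp
  nlinarith [mul_lt_mul_of_pos_left hz2 hz4, mul_pos hz4 hx]

/-- Flowing the superlevel set slightly below a level `t` into a neighbourhood of the open
superlevel set at `t` and the critical points. -/
lemma exists_level_flow {g : E → ℝ} (hg : ContDiff ℝ 2 g) {G : E → E} (hG : Continuous G)
    (hgG : ∀ x, fderiv ℝ g x ≠ 0 → 0 < fderiv ℝ g x (G x))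
    (hK : IsCompact {x | 0 ≤ g x}) {t : ℝ} (ht : 0 < t) {W : Set E} (hW : IsOpen W)
    (hVW : {x | t < g x} ⊆ W) (hcW : ∀ x, fderiv ℝ g x = 0 → g x = t → x ∈ W) :
    ∃ η : ℝ, ∃ s, 0 ≤ s ∧ s < t ∧ ∀ x, s < g x →
      x + η • G x ∈ W ∧ ∀ τ ∈ Set.Icc (0 : ℝ) 1, 0 < g (x + (τ * η) • G x) := by
  have hgc : Continuous g := hg.continuous
  have hKt : IsCompact {x | t ≤ g x} :=
    hK.of_isClosed_subset (isClosed_le continuous_const hgc) fun x hx ↦ ht.le.trans hx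
  have hloc : ∀ x ∈ {x | t ≤ g x}, ∀ᶠ z : E × ℝ in 𝓝 x ×ˢ 𝓝[>] 0,
      t ≤ g z.1 → z.1 + z.2 • G z.1 ∈ W ∧ 0 < g (z.1 + z.2 • G z.1) := by
    intro x hx
    have hlim : Tendsto (fun z : E × ℝ ↦ z.1 + z.2 • G z.1) (𝓝 x ×ˢ 𝓝[>] 0) (𝓝 x) := by
      have : ContinuousAt (fun z : E × ℝ ↦ z.1 + z.2 • G z.1) (x, 0) := by fun_prop
      have h2 := this.tendsto.mono_left (nhds_prod_eq.trans_ge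
        (Filter.prod_mono le_rfl (nhdsWithin_le_nhds (s := Set.Ioi 0))))
      simpa using h2
    by_cases hxW : x ∈ W
    · filter_upwards [hlim.eventually (hW.mem_nhds hxW), hlim.eventually
        ((isOpen_lt continuous_const hgc).mem_nhds (ht.trans_le hx))] with z h1 h2 _
      exact ⟨h1, h2⟩
    · have hxt : g x = t := le_antisymm (not_lt.1 fun h ↦ hxW (hVW h)) hx
      filter_upwards [eventually_lt_along_field hg hG (hgG x fun h ↦ hxW (hcW x h hxt))] with z h h'
      exact ⟨hVW (h'.trans_lt h), ht.trans (h'.trans_lt h)⟩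
  have hη : ∀ᶠ η in 𝓝[>] (0 : ℝ), ∀ x ∈ {x | t ≤ g x}, t ≤ g x →
      x + η • G x ∈ W ∧ 0 < g (x + η • G x) :=
    (eventually_swap_iff.1 (hKt.mem_nhdsSet_prod_of_forall hloc)).curry.mono
      fun _ h x hx ↦ h.self_of_nhdsSet x hx
  obtain ⟨η, hη0, hη⟩ := (mem_nhdsGT_iff_exists_Ioc_subset).1 hη
  have hη0 : 0 < η := hη0
  let Good : Set E := {x | x + η • G x ∈ W ∧ ∀ τ ∈ Set.Icc (0 : ℝ) 1, 0 < g (x + (τ * η) • G x)}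
  have hGood : IsOpen Good := by
    refine (hW.preimage (by fun_prop)).inter ?_
    refine isOpen_iff_eventually.2 fun x hx ↦ ?_
    refine isCompact_Icc.eventually_forall_of_forall_eventually fun τ hτ ↦ ?_
    have : ContinuousAt (fun z : E × ℝ ↦ g (z.1 + (z.2 * η) • G z.1)) (x, τ) := by fun_prop
    exact this.eventually_const_lt (hx τ hτ)
  have hsub : {x | t ≤ g x} ⊆ Good := by
    intro x hx
    refine ⟨(hη (Set.right_mem_Ioc.2 hη0) x hx hx).1, fun τ hτ ↦ ?_⟩
    rcases hτ.1.eq_or_lt with rfl | hτ0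
    · simpa using ht.trans_le hx
    · exact (hη ⟨mul_pos hτ0 hη0, mul_le_of_le_one_left hη0.le hτ.2⟩ x hx hx).2
  have hbad : IsCompact ({x | 0 ≤ g x} \ Good) := hK.diff hGood
  rcases ({x | 0 ≤ g x} \ Good).eq_empty_or_nonempty with he | hne
  · refine ⟨η, 0, le_rfl, ht, fun x hx ↦ ?_⟩
    by_contra hx'
    have : x ∈ {x | 0 ≤ g x} \ Good := ⟨hx.le, hx'⟩
    rw [he] at this
    exact this
  · obtain ⟨m, hm, hmax⟩ := hbad.exists_isMaxOn hne hgc.continuousOn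
    refine ⟨η, g m, hm.1, not_le.1 fun h ↦ hm.2 (hsub h), fun x hx ↦ ?_⟩
    by_contra hx'
    have h0 : (0 : ℝ) ≤ g m := hm.1
    have : x ∈ {x | 0 ≤ g x} \ Good := ⟨h0.trans hx.le, hx'⟩
    exact (hmax this).not_gt hx

end MorseFlow

namespace PathChain

open Filter Topology

variable {E : Type} [NormedAddCommGroup E] [NormedSpace ℝ E]

lemma rank_classesOn_union_balls_le [Nontrivial E] {U V : Set E} {L : Type} [Fintype L]
    (hV : IsOpen V) {R : ℝ} {r : E → ℝ} {label : E → E → L} (S : Finset E)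
    (hrR : ∀ p ∈ S, r p ≤ R) (hR : ∀ p ∈ S, ∀ q ∈ S, p ≠ q → 2 * R ≤ dist p q)
    (hU : ∀ p ∈ S, Metric.ball p R ⊆ U)
    (hl : ∀ p ∈ S, ∀ x ∈ Metric.ball p (r p), ∀ y ∈ Metric.ball p (r p), x ∈ V → y ∈ V →
      label p x = label p y → JoinedIn (V ∩ Metric.ball p R) x y) :
    Module.rank (ZMod 2) (classesOn U (V ∪ ⋃ p ∈ S, Metric.ball p (r p))) ≤
      Module.rank (ZMod 2) (classesOn U V) + (Fintype.card L * S.card : ℕ) := by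
  classical
  induction S using Finset.induction_on with
  | empty => exact (Submodule.rank_mono (classesOn_mono (T := V) (by simp))).trans (by simp)
  | insert p S hp ih =>
    have ih := ih (fun q hq ↦ hrR q (Finset.mem_insert_of_mem hq))
      (fun q hq q' hq' ↦ hR q (Finset.mem_insert_of_mem hq) q' (Finset.mem_insert_of_mem hq'))
      (fun q hq ↦ hU q (Finset.mem_insert_of_mem hq))
      (fun q hq ↦ hl q (Finset.mem_insert_of_mem hq))
    have hpS := Finset.mem_insert_self p S
    have hset : (V ∪ ⋃ q ∈ insert p S, Metric.ball q (r q)) =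
        (V ∪ ⋃ q ∈ S, Metric.ball q (r q)) ∪ Metric.ball p (r p) := by
      rw [Finset.set_biUnion_insert, Set.union_comm (Metric.ball p _), Set.union_assoc]
    have hin {x : E} (hx : x ∈ (V ∪ ⋃ q ∈ S, Metric.ball q (r q)) ∩ Metric.ball p (r p)) :
        x ∈ V := by
      refine hx.1.resolve_right fun h ↦ ?_
      obtain ⟨q, hq, hxq⟩ := Set.mem_iUnion₂.1 h
      have hqS := Finset.mem_insert_of_mem (a := q) (b := p) hq
      have h1 := hR p hpS q hqS (by rintro rfl; exact hp hq)
      have h2 := Metric.mem_ball'.1 hx.2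
      have h3 := Metric.mem_ball.1 hxq
      linarith [dist_triangle p x q, hrR p hpS, hrR q hqS]
    have hstep := rank_classesOn_union_le (U := U)
      (hV.union (isOpen_biUnion fun q (_ : q ∈ S) ↦ Metric.isOpen_ball (x := q) (ε := r q)))
      (Metric.isOpen_ball (x := p) (ε := r p)) (Metric.ball_subset_ball (hrR p hpS))
      (convex_ball p R) (hU p hpS) (label p) fun x hx y hy hxy ↦
        (hl p hpS x hx.2 y hy.2 (hin hx) (hin hy) hxy).mono
          (Set.inter_subset_inter_left _ Set.subset_union_left)
    rw [hset, Finset.card_insert_of_notMem hp]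
    refine hstep.trans ((add_le_add_left ih _).trans_eq ?_)
    rw [add_assoc]
    push_cast
    rw [mul_add, mul_one]

section

variable [FiniteDimensional ℝ E] [Nontrivial E] {g : E → ℝ} (hg : ContDiff ℝ 2 g) {G : E → E}
  (hG : Continuous G)
  (hgG : ∀ x, fderiv ℝ g x ≠ 0 → 0 < fderiv ℝ g x (G x))
  (hK : IsCompact {x | 0 ≤ g x}) {U : Set E} (hU : {x | 0 < g x} ⊆ U)
  (hnd : ∀ p, fderiv ℝ g p = 0 → ∀ v, fderiv ℝ (fderiv ℝ g) p v = 0 → v = 0)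

include hg hG hgG hK hU hnd

lemma exists_rank_superlevel_le_add {t : ℝ} (ht : 0 < t) (S : Finset E)
    (hS : ∀ p, p ∈ S ↔ fderiv ℝ g p = 0 ∧ g p = t) :
    ∃ s, 0 ≤ s ∧ s < t ∧ Module.rank (ZMod 2) (classesOn U {x | s < g x}) ≤
      Module.rank (ZMod 2) (classesOn U {x | t < g x}) +
        (Module.finrank ℝ E * 2 * S.card : ℕ) := by
  have hgc : Continuous g := hg.continuous
  have h1 : ∀ᶠ R in 𝓝[>] (0 : ℝ), ∀ p ∈ S, ∀ q ∈ S, p ≠ q → 2 * R ≤ dist p q := by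
    simp only [eventually_all_finset]
    intro p _ q _
    by_cases hpq : p = q
    · simp [hpq]
    · have : ContinuousAt (fun R : ℝ ↦ 2 * R) 0 := by fun_prop
      filter_upwards [(this.eventually_lt_const (u := dist p q)
        (by simpa using hpq)).filter_mono nhdsWithin_le_nhds] with R hR _
      exact hR.le
  have h2 : ∀ᶠ R in 𝓝[>] (0 : ℝ), ∀ p ∈ S, Metric.ball p R ⊆ {x | 0 < g x} := by
    simp only [eventually_all_finset]
    intro p hp
    have hp0 : 0 < g p := ((hS p).1 hp).2 ▸ ht
    obtain ⟨R, hR, hb⟩ := Metric.isOpen_iff.1 (isOpen_lt continuous_const hgc) p hp0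
    filter_upwards [Ioo_mem_nhdsGT hR] with R' hR'
    exact (Metric.ball_subset_ball hR'.2.le).trans hb
  obtain ⟨R, ⟨hR1, hR2⟩, hR0⟩ := ((h1.and h2).and eventually_mem_nhdsWithin).exists
  have : NeZero (Module.finrank ℝ E) := ⟨Module.finrank_pos.ne'⟩
  have hloc := fun p hp ↦ exists_label_of_nondegenerate hg (p := p) hp (hnd p hp) hR0
  choose! r hr0 hrR label hlabel using hloc
  set W := {x | t < g x} ∪ ⋃ p ∈ S, Metric.ball p (r p) with hW
  have hVo : IsOpen {x | t < g x} := isOpen_lt continuous_const hgc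
  obtain ⟨η, s, hs0, hst, hflow⟩ := exists_level_flow hg hG hgG hK ht (W := W)
    (hVo.union (isOpen_biUnion fun q _ ↦ Metric.isOpen_ball)) Set.subset_union_left
    fun x hx hxt ↦ Or.inr <| Set.mem_iUnion₂.2
      ⟨x, (hS x).2 ⟨hx, hxt⟩, Metric.mem_ball_self (hr0 x hx)⟩
  refine ⟨s, hs0, hst, ?_⟩
  have hle : classesOn U {x | s < g x} ≤ classesOn U W :=
    classesOn_le_of_homotopy (fun x τ ↦ x + (τ * η) • G x)
      (Continuous.continuousOn (by fun_prop)) (fun x hx τ hτ ↦ hU ((hflow x hx).2 τ hτ))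
      (by simp) (fun x hx ↦ by simpa using (hflow x hx).1)
  have hballs := rank_classesOn_union_balls_le (U := U) hVo (R := R) (r := r) (label := label) S
    (fun p hp ↦ hrR p ((hS p).1 hp).1) hR1 (fun p hp ↦ (hR2 p hp).trans hU)
    (fun p hp x hx y hy hxt hyt hxy ↦ by
      have hpt := ((hS p).1 hp).2
      have := hlabel p ((hS p).1 hp).1 x hx y hy (by rwa [hpt]) (by rwa [hpt]) hxy
      rwa [hpt] at this)
  refine (Submodule.rank_mono hle).trans (hballs.trans_eq ?_)
  simp [mul_comm]

/-- Morse inequality: the superlevel set of a function with nondegenerate critical points has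
first Betti number bounded by the number of its critical points, up to a constant. -/
theorem rank_superlevel_le (hfin : {x | fderiv ℝ g x = 0}.Finite) :
    Module.rank (ZMod 2) (classesOn U {x | 0 < g x}) ≤
      (Module.finrank ℝ E * 2 * hfin.toFinset.card : ℕ) := by
  classical
  set d := Module.finrank ℝ E * 2
  have hgc : Continuous g := hg.continuous
  let Pr (t : ℝ) : Prop := Module.rank (ZMod 2) (classesOn U {x | t < g x}) ≤
    (d * (hfin.toFinset.filter (t < g ·)).card : ℕ)
  obtain ⟨T, hT0, hT⟩ : ∃ T, 0 ≤ T ∧ ∀ x, g x ≤ T := by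
    rcases {x | 0 ≤ g x}.eq_empty_or_nonempty with he | hne
    · refine ⟨0, le_rfl, fun x ↦ ?_⟩
      by_contra! h
      have : x ∈ {x | 0 ≤ g x} := h.le
      rw [he] at this
      exact this
    · obtain ⟨m, hm, hmax⟩ := hK.exists_isMaxOn hne hgc.continuousOn
      refine ⟨g m, hm, fun x ↦ ?_⟩
      rcases le_total 0 (g x) with h | h
      · exact hmax h
      · exact h.trans hm
  have hPT : Pr T := by
    have : {x | T < g x} = ∅ := by
      ext x; simpa using hT x
    have hle : classesOn U {x | T < g x} ≤ ⊥ :=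
      (classesOn_mono this.subset).trans (classesOn_empty U).le
    refine (Submodule.rank_mono hle).trans ?_
    simp
  have hlimit {t : ℝ} (ht : t < T) (h : ∀ s, t < s → s ≤ T → Pr s) : Pr t := by
    refine rank_le_of_forall_finset fun F hF ↦ ?_
    obtain ⟨K, hKt, hKc, hFK⟩ := exists_isCompact_classesIn F hF
    obtain ⟨s, hts, hsT, hs⟩ : ∃ s, t < s ∧ s ≤ T ∧ ∀ x ∈ K, s < g x := by
      rcases K.eq_empty_or_nonempty with rfl | hne
      · exact ⟨T, ht, le_rfl, by simp⟩
      · obtain ⟨m, hm, hmin⟩ := hKc.exists_isMinOn hne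
          (hgc.comp continuous_subtype_val).continuousOn
        have hm' : t < g m := hKt hm
        obtain ⟨s, hs1, hs2⟩ := exists_between hm'
        exact ⟨s, hs1, hs2.le.trans (hT _), fun x hx ↦ hs2.trans_le (hmin hx)⟩
    refine ⟨classesOn U {x | s < g x}, (h s hts hsT).trans ?_,
      hFK.trans (classesIn_mono fun x hx ↦ hs x hx)⟩
    refine Nat.cast_le.2 (Nat.mul_le_mul_left _ (Finset.card_le_card ?_))
    exact Finset.monotone_filter_right _ fun x _ hx ↦ hts.trans hx
  have hstep {t : ℝ} (ht : 0 < t) (h : Pr t) :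
      ∃ s, 0 ≤ s ∧ s < t ∧ ∀ s', s ≤ s' → s' < t → Pr s' := by
    obtain ⟨s, hs0, hst, hs⟩ := exists_rank_superlevel_le_add hg hG hgG hK hU hnd ht
      (hfin.toFinset.filter (g · = t)) (by simp)
    refine ⟨s, hs0, hst, fun s' hs' hs't ↦ ?_⟩
    have h1 : Module.rank (ZMod 2) (classesOn U {x | s' < g x}) ≤ _ :=
      (Submodule.rank_mono (classesOn_mono fun x hx ↦ hs'.trans_lt hx)).trans hs
    refine h1.trans ((add_le_add_left h _).trans ?_)
    rw [← Nat.cast_add, ← mul_add]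
    refine Nat.cast_le.2 (Nat.mul_le_mul_left _ ?_)
    rw [← Finset.card_union_of_disjoint]
    · refine Finset.card_le_card fun x hx ↦ ?_
      simp only [Finset.mem_union, Finset.mem_filter] at hx ⊢
      rcases hx with hx | hx
      · exact ⟨hx.1, hs't.trans hx.2⟩
      · exact ⟨hx.1, hx.2 ▸ hs't⟩
    · refine Finset.disjoint_filter.2 fun x _ h h' ↦ ?_
      exact h.ne' h'
  let A : Set ℝ := {t | 0 ≤ t ∧ t ≤ T ∧ ∀ s, t ≤ s → s ≤ T → Pr s}
  have hTA : T ∈ A := ⟨hT0, le_rfl, fun s h1 h2 ↦ by rwa [le_antisymm h2 h1]⟩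
  have hbdd : BddBelow A := ⟨0, fun t ht ↦ ht.1⟩
  have ht0 : 0 ≤ sInf A := le_csInf ⟨T, hTA⟩ fun t ht ↦ ht.1
  have hA1 (s : ℝ) (h1 : sInf A < s) (h2 : s ≤ T) : Pr s := by
    obtain ⟨t, ht, hts⟩ := exists_lt_of_csInf_lt ⟨T, hTA⟩ h1
    exact ht.2.2 s hts.le h2
  have hA2 : Pr (sInf A) := by
    rcases (csInf_le hbdd hTA).eq_or_lt with h | h
    · rw [h]; exact hPT
    · exact hlimit h hA1
  have hzero : sInf A = 0 := by
    by_contra hne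
    obtain ⟨s, hs0, hst, hs⟩ := hstep (lt_of_le_of_ne ht0 (Ne.symm hne)) hA2
    have : s ∈ A := by
      refine ⟨hs0, hst.le.trans (csInf_le hbdd hTA), fun s' h1 h2 ↦ ?_⟩
      rcases lt_trichotomy s' (sInf A) with h | h | h
      · exact hs s' h1 h
      · rw [h]; exact hA2
      · exact hA1 s' h h2
    exact (csInf_le hbdd this).not_gt hst
  rw [hzero] at hA2
  exact hA2.trans (Nat.cast_le.2 (Nat.mul_le_mul_left _ (Finset.card_filter_le _ _)))

end

end PathChain

namespace MvPolynomial

variable {σ : Type} [Fintype σ]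

lemma hasFDerivAt_eval (p : MvPolynomial σ ℝ) (x : σ → ℝ) :
    HasFDerivAt (fun y ↦ eval y p)
      (∑ j, eval x (pderiv j p) • (ContinuousLinearMap.proj j : (σ → ℝ) →L[ℝ] ℝ)) x := by
  classical
  induction p using MvPolynomial.induction_on with
  | C a => simpa using hasFDerivAt_const a x
  | add p q hp hq =>
    simp only [map_add, add_smul, Finset.sum_add_distrib]
    exact hp.add hq
  | mul_X p i hp =>
    have hX : HasFDerivAt (fun y : σ → ℝ ↦ y i) (ContinuousLinearMap.proj i : (σ → ℝ) →L[ℝ] ℝ) x :=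
      (ContinuousLinearMap.proj i : (σ → ℝ) →L[ℝ] ℝ).hasFDerivAt
    simp only [map_mul, eval_X]
    refine (hp.mul hX).congr_fderiv ?_
    simp only [Derivation.leibniz, smul_eq_mul, map_add, map_mul, eval_X, add_smul,
      Finset.sum_add_distrib, pderiv_X, Pi.single_apply, Finset.smul_sum, mul_smul, apply_ite,
      map_zero, mul_one, mul_zero, zero_smul, ite_smul]
    simp

lemma totalDegree_pderiv_le {R : Type*} [CommSemiring R] {τ : Type*} (p : MvPolynomial τ R)
    (i : τ) : (pderiv i p).totalDegree ≤ p.totalDegree - 1 := by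
  classical
  conv_lhs => rw [p.as_sum, map_sum]
  refine totalDegree_finsetSum_le fun s hs ↦ ?_
  rw [pderiv_monomial]
  by_cases hsi : s i = 0
  · simp [hsi]
  refine (totalDegree_monomial_le _ _).trans ?_
  have h1 : Finsupp.degree (s - Finsupp.single i 1) + 1 = Finsupp.degree s := by
    have : s - Finsupp.single i 1 + Finsupp.single i 1 = s :=
      tsub_add_cancel_of_le (Finsupp.single_le_iff.2 (Nat.one_le_iff_ne_zero.2 hsi))
    conv_rhs => rw [← this, map_add]
    simp
  have h2 : Finsupp.degree s ≤ p.totalDegree := le_totalDegree hs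
  change Finsupp.degree (s - Finsupp.single i 1) ≤ _
  omega


lemma card_le_of_linearIndependent {K : Type*} [Field K] {ι : Type*} [Fintype ι] {m : ℕ}
    {p : ι → MvPolynomial σ K} (hp : LinearIndependent K p) (hm : ∀ i, (p i).totalDegree ≤ m) :
    Fintype.card ι ≤ (m + 1) ^ Fintype.card σ := by
  classical
  let s : Set (σ →₀ ℕ) := {e | ∀ i, e i ≤ m}
  have hpm (i : ι) : p i ∈ restrictSupport K s := by
    refine (mem_restrictSupport_iff K).2 fun e he j ↦ ?_
    exact (Finsupp.le_degree j e).trans ((le_totalDegree he).trans (hm i))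
  let φ : s → σ → Fin (m + 1) := fun e i ↦ ⟨e.1 i, Nat.lt_succ_of_le (e.2 i)⟩
  have hφ : Function.Injective φ := fun e e' h ↦ by
    refine Subtype.ext (Finsupp.ext fun i ↦ ?_)
    exact congr_arg Fin.val (congr_fun h i)
  have : Finite s := Finite.of_injective φ hφ
  have : Module.Finite K (restrictSupport K s) := Module.Finite.of_basis (basisRestrictSupport K s)
  have hli : LinearIndependent K (fun i ↦ (⟨p i, hpm i⟩ : restrictSupport K s)) :=
    LinearIndependent.of_comp (restrictSupport K s).subtype hp
  refine hli.fintype_card_le_finrank.trans ?_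
  rw [Module.finrank_eq_nat_card_basis (basisRestrictSupport K s)]
  refine (Nat.card_le_card_of_injective φ hφ).trans ?_
  simp

open Filter Topology in
/-- If the leading form at `x` of a combination of products of the polynomials `G i` vanishes,
and the linear parts of the `G i` at `x` are independent, so do its coefficients. -/
lemma coeff_eq_zero_of_sum_mul_prod_eq_zero [DecidableEq σ] {ι : Type} [Fintype ι]
    {M : ℕ}     {G : σ → MvPolynomial σ ℝ} {q : ι → MvPolynomial σ ℝ}
    {c : ι × (σ → Fin M) → ℝ} (hc : ∑ a, c a • (q a.1 * ∏ i, G i ^ (a.2 i : ℕ)) = 0)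
    {x : σ → ℝ} (hG : ∀ i, eval x (G i) = 0)
    (hJ : ∀ v : σ → ℝ, (∀ i, ∑ j, eval x (pderiv j (G i)) * v j = 0) → v = 0)
    {k : ι} (hk : eval x (q k) ≠ 0) (hk' : ∀ l ≠ k, eval x (q l) = 0) {m : ℕ}
    (hm : ∀ a, ∑ i, (a.2 i : ℕ) < m → c a = 0) (β : σ → Fin M) (hβ : ∑ i, (β i : ℕ) = m) :
    c (k, β) = 0 := by
  classical
  let A : (σ → ℝ) →ₗ[ℝ] (σ → ℝ) :=
    { toFun := fun v i ↦ ∑ j, eval x (pderiv j (G i)) * v j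
      map_add' := fun v w ↦ by ext i; simp [mul_add, Finset.sum_add_distrib]
      map_smul' := fun r v ↦ by ext i; simp [Finset.mul_sum, mul_left_comm] }
  have hA : Function.Surjective A := LinearMap.injective_iff_surjective.1 <|
    (injective_iff_map_eq_zero A).2 fun v hv ↦ hJ v (congr_fun hv)
  have hkey (v : σ → ℝ) : ∑ a : ι × (σ → Fin M), (if ∑ i, (a.2 i : ℕ) = m then
      c a * (eval x (q a.1) * ∏ i, A v i ^ (a.2 i : ℕ)) else 0) = 0 := by
    have hline : Tendsto (fun t : ℝ ↦ x + t • v) (𝓝[≠] 0) (𝓝 x) := by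
      have : Continuous (fun t : ℝ ↦ x + t • v) := by fun_prop
      simpa using (this.tendsto 0).mono_left nhdsWithin_le_nhds
    have hGt (i : σ) : Tendsto (fun t : ℝ ↦ t⁻¹ * eval (x + t • v) (G i)) (𝓝[≠] 0)
        (𝓝 (A v i)) := by
      have h1 := (hasFDerivAt_eval (G i) x).hasLineDerivAt v
      have h2 := h1.tendsto_slope_zero
      simpa [hG i, A] using h2
    refine tendsto_nhds_unique (f := fun t : ℝ ↦ (t⁻¹) ^ m *
      eval (x + t • v) (∑ a, c a • (q a.1 * ∏ i, G i ^ (a.2 i : ℕ)))) (l := 𝓝[≠] 0) ?_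
      (by rw [hc]; simp)
    simp only [map_sum, smul_eval, Finset.mul_sum, map_mul, map_prod, map_pow]
    refine tendsto_finsetSum _ fun a _ ↦ ?_
    rcases lt_or_ge (∑ i, (a.2 i : ℕ)) m with h | h
    · simp [hm a h, h.ne]
    have hlim : Tendsto (fun t : ℝ ↦ t ^ (∑ i, (a.2 i : ℕ) - m) * (c a * (eval (x + t • v) (q a.1) *
        ∏ i, (t⁻¹ * eval (x + t • v) (G i)) ^ (a.2 i : ℕ)))) (𝓝[≠] 0)
        (𝓝 (0 ^ (∑ i, (a.2 i : ℕ) - m) * (c a * (eval x (q a.1) *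
          ∏ i, A v i ^ (a.2 i : ℕ))))) :=
      ((tendsto_id.mono_left nhdsWithin_le_nhds).pow _).mul <| Tendsto.const_mul _ <|
        (((MvPolynomial.continuous_eval _).tendsto x).comp hline).mul <|
          tendsto_finsetProd _ fun i _ ↦ (hGt i).pow _
    refine (hlim.congr' ?_).trans (le_of_eq ?_)
    · filter_upwards [self_mem_nhdsWithin] with t ht
      have ht : t ≠ 0 := ht
      simp only [mul_pow, Finset.prod_mul_distrib, Finset.prod_pow_eq_pow_sum]
      have : t ^ (∑ i, (a.2 i : ℕ) - m) * t⁻¹ ^ (∑ i, (a.2 i : ℕ)) = t⁻¹ ^ m := by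
        rw [pow_sub₀ _ ht h, inv_pow, inv_pow]
        field_simp
      rw [← this]
      ring
    · rcases h.eq_or_lt with h | h
      · simp [← h]
      · simp [h.ne', Nat.sub_ne_zero_of_lt h]
  have hpoly : ∑ γ : σ → Fin M, (if ∑ i, (γ i : ℕ) = m then
      monomial (Finsupp.equivFunOnFinite.symm fun i ↦ (γ i : ℕ)) (c (k, γ)) else 0) = 0 := by
    refine MvPolynomial.funext fun y ↦ ?_
    obtain ⟨v, rfl⟩ := hA y
    have := hkey v
    rw [Fintype.sum_prod_type, Finset.sum_eq_single k] at this
    · rw [map_zero, map_sum]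
      refine mul_left_cancel₀ hk ?_
      rw [mul_zero, ← this, Finset.mul_sum]
      refine Finset.sum_congr rfl fun γ _ ↦ ?_
      split_ifs
      · rw [eval_monomial, Finsupp.prod_fintype _ _ (by simp)]
        simp only [Finsupp.equivFunOnFinite_symm_apply_apply]
        ring
      · simp
    · intro l _ hl
      simp [hk' l hl]
    · simp
  have := congr_arg (coeff (Finsupp.equivFunOnFinite.symm fun i ↦ (β i : ℕ))) hpoly
  rw [coeff_sum, Finset.sum_eq_single β] at this
  · simpa [hβ] using this
  · intro γ _ hγ
    split_ifs
    · rw [coeff_monomial, if_neg]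
      exact fun h ↦ hγ <| _root_.funext fun i ↦
        Fin.ext (congr_fun (Finsupp.equivFunOnFinite.symm.injective h) i)
    · simp
  · simp

/-- A Bézout-type bound for the number of nondegenerate common zeros. -/
theorem card_le_of_forall_nondegenerate {G : σ → MvPolynomial σ ℝ} {d : ℕ}
    (hd : ∀ i, (G i).totalDegree ≤ d) (S : Finset (σ → ℝ))
    (hG : ∀ x ∈ S, ∀ i, eval x (G i) = 0)
    (hJ : ∀ x ∈ S, ∀ v : σ → ℝ, (∀ i, ∑ j, eval x (pderiv j (G i)) * v j = 0) → v = 0) :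
    S.card ≤ (Fintype.card σ * d + 1) ^ Fintype.card σ := by
  classical
  set n := Fintype.card σ
  let q : S → MvPolynomial σ ℝ := fun k ↦
    ∏ l ∈ S.erase k, ∑ i, (X i - C (l i)) ^ 2
  have hq (k l : S) (hkl : k ≠ l) : eval (k : σ → ℝ) (q l) = 0 := by
    simp only [q, map_prod]
    refine Finset.prod_eq_zero (Finset.mem_erase.2 ⟨Subtype.coe_ne_coe.2 hkl, k.2⟩) ?_
    simp
  have hq' (k : S) : eval (k : σ → ℝ) (q k) ≠ 0 := by
    simp only [q, map_prod]
    refine Finset.prod_ne_zero_iff.2 fun l hl ↦ ?_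
    simp only [map_sum, map_pow, map_sub, eval_X, eval_C]
    rw [Ne, Finset.sum_eq_zero_iff_of_nonneg fun i _ ↦ sq_nonneg _]
    intro h
    refine (Finset.mem_erase.1 hl).1 (_root_.funext fun i ↦ ?_)
    have := h i (Finset.mem_univ i)
    linarith [pow_eq_zero_iff (two_ne_zero) |>.1 this]
  set c := 2 * S.card
  have hqd (k : S) : (q k).totalDegree ≤ c := by
    refine (totalDegree_finsetProd _ _).trans ?_
    refine (Finset.sum_le_card_nsmul _ _ 2 fun l _ ↦ ?_).trans ?_
    · refine totalDegree_finsetSum_le fun i _ ↦ (totalDegree_pow _ _).trans ?_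
      have : (X i - C (l i) : MvPolynomial σ ℝ).totalDegree ≤ 1 :=
        (totalDegree_sub _ _).trans (by simp)
      omega
    · rw [smul_eq_mul, mul_comm]
      exact Nat.mul_le_mul_left _ (Finset.card_le_card (Finset.erase_subset _ _))
  set M := c + 1
  let p : S × (σ → Fin M) → MvPolynomial σ ℝ := fun a ↦ q a.1 * ∏ i, G i ^ (a.2 i : ℕ)
  have hpd (a) : (p a).totalDegree ≤ c + n * (c * d) := by
    refine (totalDegree_mul _ _).trans (add_le_add (hqd _) ?_)
    refine (totalDegree_finsetProd _ _).trans ?_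
    refine (Finset.sum_le_card_nsmul _ _ (c * d) fun i _ ↦ ?_).trans_eq (by simp [n])
    exact (totalDegree_pow _ _).trans (Nat.mul_le_mul (Nat.lt_succ_iff.1 (a.2 i).2) (hd i))
  have hp : LinearIndependent ℝ p := by
    refine Fintype.linearIndependent_iff.2 fun w hw ↦ ?_
    have key (m : ℕ) : ∀ a, ∑ i, (a.2 i : ℕ) = m → w a = 0 := by
      induction m using Nat.strong_induction_on with
      | _ m ih =>
        rintro ⟨k, β⟩ hβ
        exact coeff_eq_zero_of_sum_mul_prod_eq_zero hw (hG k k.2) (hJ k k.2) (hq' k)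
          (fun l hl ↦ hq k l hl.symm) (fun a ha ↦ ih _ ha a rfl) β hβ
    exact fun a ↦ key _ a rfl
  have hcard := card_le_of_linearIndependent hp hpd
  simp only [Fintype.card_prod, Fintype.card_coe, Fintype.card_fun, Fintype.card_fin] at hcard
  refine Nat.le_of_mul_le_mul_right (c := M ^ n) ?_ (by positivity)
  refine hcard.trans ?_
  rw [← mul_pow]
  refine Nat.pow_le_pow_left ?_ _
  simp only [M]
  nlinarith [Nat.zero_le (n * d)]

lemma contDiff_eval (p : MvPolynomial σ ℝ) {n : WithTop ℕ∞} : ContDiff ℝ n fun x ↦ eval x p :=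
  contDiff_iff_contDiffAt.2 fun x ↦
    (AnalyticOnNhd.eval_mvPolynomial p x (Set.mem_univ x)).contDiffAt

lemma fderiv_eval (p : MvPolynomial σ ℝ) :
    fderiv ℝ (fun x ↦ eval x p) = fun x ↦
      ∑ j, eval x (pderiv j p) • (ContinuousLinearMap.proj j : (σ → ℝ) →L[ℝ] ℝ) :=
  _root_.funext fun x ↦ (hasFDerivAt_eval p x).fderiv

lemma fderiv_eval_apply (p : MvPolynomial σ ℝ) (x v : σ → ℝ) :
    fderiv ℝ (fun x ↦ eval x p) x v = ∑ j, eval x (pderiv j p) * v j := by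
  simp [fderiv_eval]

lemma fderiv_eval_eq_zero_iff [DecidableEq σ] {p : MvPolynomial σ ℝ} {x : σ → ℝ} :
    fderiv ℝ (fun x ↦ eval x p) x = 0 ↔ ∀ i, eval x (pderiv i p) = 0 := by
  refine ⟨fun h i ↦ ?_, fun h ↦ by simp [fderiv_eval, h]⟩
  have := fderiv_eval_apply p x (Pi.single i 1)
  rw [h] at this
  simpa [Pi.single_apply] using this.symm

lemma fderiv_fderiv_eval_apply [DecidableEq σ] (p : MvPolynomial σ ℝ) (x v : σ → ℝ) (i : σ) :
    fderiv ℝ (fderiv ℝ (fun x ↦ eval x p)) x v (Pi.single i 1) =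
      ∑ j, eval x (pderiv j (pderiv i p)) * v j := by
  have h : HasFDerivAt (fun x : σ → ℝ ↦
      ∑ j, eval x (pderiv j p) • (ContinuousLinearMap.proj j : (σ → ℝ) →L[ℝ] ℝ)) _ x :=
    HasFDerivAt.fun_sum fun j _ ↦ (hasFDerivAt_eval (pderiv j p) x).smul_const
      (ContinuousLinearMap.proj j : (σ → ℝ) →L[ℝ] ℝ)
  rw [fderiv_eval, h.fderiv]
  simp [Pi.single_apply]

/-- Sard's theorem: a generic linear perturbation of a polynomial has nondegenerate critical
points. -/
lemma exists_forall_nondegenerate (p : MvPolynomial σ ℝ) {δ : ℝ} (hδ : 0 < δ) :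
    ∃ a : σ → ℝ, (∀ i, |a i| < δ) ∧ ∀ x,
      (∀ i, eval x (pderiv i (p - ∑ k, C (a k) * X k)) = 0) → ∀ v : σ → ℝ,
      (∀ i, ∑ j, eval x (pderiv j (pderiv i (p - ∑ k, C (a k) * X k))) * v j = 0) → v = 0 := by
  classical
  let φ : (σ → ℝ) → σ → ℝ := fun x i ↦ eval x (pderiv i p)
  let φ' : (σ → ℝ) → (σ → ℝ) →L[ℝ] σ → ℝ := fun x ↦ ContinuousLinearMap.pi fun i ↦
    ∑ j, eval x (pderiv j (pderiv i p)) • (ContinuousLinearMap.proj j : (σ → ℝ) →L[ℝ] ℝ)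
  have hφ (x) : HasFDerivAt φ (φ' x) x := hasFDerivAt_pi.2 fun i ↦ hasFDerivAt_eval _ x
  have hsard : MeasureTheory.volume (φ '' {x | (φ' x).det = 0}) = 0 :=
    MeasureTheory.addHaar_image_eq_zero_of_det_fderivWithin_eq_zero _
      (fun x _ ↦ (hφ x).hasFDerivWithinAt) fun x hx ↦ hx
  obtain ⟨a, haδ, ha⟩ : ∃ a ∈ Metric.ball (0 : σ → ℝ) δ, a ∉ φ '' {x | (φ' x).det = 0} := by
    by_contra! h
    exact (Metric.measure_ball_pos MeasureTheory.volume (0 : σ → ℝ) hδ).ne'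
      (MeasureTheory.measure_mono_null h hsard)
  have hgrad (i : σ) : pderiv i (p - ∑ k, C (a k) * X k) = pderiv i p - C (a i) := by
    rw [map_sub, map_sum]
    congr 1
    simp [Derivation.leibniz, pderiv_X, Pi.single_apply]
  refine ⟨a, fun i ↦ ?_, fun x hx v hv ↦ ?_⟩
  · exact (norm_le_pi_norm a i).trans_lt (mem_ball_zero_iff.1 haδ)
  · simp only [hgrad, map_sub, pderiv_C, sub_zero, eval_C] at hx hv
    have hdet : (φ' x).det ≠ 0 := fun h ↦ ha ⟨x, h, _root_.funext fun i ↦ sub_eq_zero.1 (hx i)⟩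
    have hinj := (LinearMap.equivOfDetNeZero (φ' x : (σ → ℝ) →ₗ[ℝ] σ → ℝ) hdet).injective
    refine hinj ?_
    rw [map_zero]
    ext i
    simpa [φ'] using hv i

lemma sq_eval_le (p : MvPolynomial σ ℝ) {D : ℕ} (hD : p.totalDegree ≤ D) :
    ∃ c, ∀ x, eval x p ^ 2 ≤ c * (1 + ∑ i, x i ^ 2) ^ D := by
  refine ⟨(∑ m ∈ p.support, |coeff m p|) ^ 2, fun x ↦ ?_⟩
  set s := ∑ i, x i ^ 2
  have hs : 0 ≤ s := Finset.sum_nonneg fun i _ ↦ sq_nonneg _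
  set r := √(1 + s) with hr
  have hr2 : r ^ 2 = 1 + s := Real.sq_sqrt (by linarith)
  have hr1 : 1 ≤ r := Real.one_le_sqrt.2 (by linarith)
  have hxr (i : σ) : |x i| ≤ r := by
    refine Real.abs_le_sqrt ?_
    have : x i ^ 2 ≤ s := Finset.single_le_sum (fun j _ ↦ sq_nonneg (x j)) (Finset.mem_univ i)
    linarith
  have habs : |eval x p| ≤ (∑ m ∈ p.support, |coeff m p|) * r ^ D := by
    rw [eval_eq', Finset.sum_mul]
    refine (Finset.abs_sum_le_sum_abs _ _).trans (Finset.sum_le_sum fun m hm ↦ ?_)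
    rw [abs_mul, Finset.abs_prod]
    refine mul_le_mul_of_nonneg_left ?_ (abs_nonneg _)
    simp only [abs_pow]
    refine (Finset.prod_le_prod (fun i _ ↦ by positivity)
      fun i _ ↦ pow_le_pow_left₀ (abs_nonneg _) (hxr i) _).trans ?_
    rw [Finset.prod_pow_eq_pow_sum]
    refine pow_le_pow_right₀ hr1 (le_trans (le_of_eq ?_) ((le_totalDegree hm).trans hD))
    rw [Finsupp.sum_fintype _ _ (by simp)]
  rw [← hr2, ← pow_mul, mul_comm 2 D, pow_mul, ← mul_pow, ← sq_abs]
  exact pow_le_pow_left₀ (abs_nonneg _) habs 2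

open PathChain in
/-- The first Betti number of a superlevel set of a polynomial, in a larger set. -/
lemma rank_superlevel_le [Nonempty σ] {p : MvPolynomial σ ℝ} {d : ℕ}
    (hd : p.totalDegree ≤ d + 1)
    (hK : IsCompact {x | 0 ≤ eval x p}) {U : Set (σ → ℝ)} (hU : {x | 0 < eval x p} ⊆ U)
    (hnd : ∀ x, (∀ i, eval x (pderiv i p) = 0) → ∀ v : σ → ℝ,
      (∀ i, ∑ j, eval x (pderiv j (pderiv i p)) * v j = 0) → v = 0) :
    Module.rank (ZMod 2) (classesOn U {x | 0 < eval x p}) ≤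
      (Fintype.card σ * 2 * (Fintype.card σ * d + 1) ^ Fintype.card σ : ℕ) := by
  classical
  have hcard (S : Finset (σ → ℝ)) (hS : ∀ x ∈ S, fderiv ℝ (fun x ↦ eval x p) x = 0) :
      S.card ≤ (Fintype.card σ * d + 1) ^ Fintype.card σ :=
    card_le_of_forall_nondegenerate (G := fun i ↦ pderiv i p)
      (fun i ↦ (totalDegree_pderiv_le p i).trans (by omega)) S
      (fun x hx ↦ fderiv_eval_eq_zero_iff.1 (hS x hx))
      fun x hx ↦ hnd x (fderiv_eval_eq_zero_iff.1 (hS x hx))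
  have hfin : {x | fderiv ℝ (fun x ↦ eval x p) x = 0}.Finite := by
    by_contra hinf
    obtain ⟨S, hS, hSc⟩ := Set.Infinite.exists_subset_card_eq hinf
      ((Fintype.card σ * d + 1) ^ Fintype.card σ + 1)
    have := hcard S fun x hx ↦ hS hx
    omega
  have h := PathChain.rank_superlevel_le (g := fun x ↦ eval x p) (contDiff_eval p)
    (G := fun x i ↦ eval x (pderiv i p))
    (continuous_pi fun i ↦ MvPolynomial.continuous_eval _)
    (fun x hx ↦ by
      rw [fderiv_eval_apply]
      refine lt_of_le_of_ne (Finset.sum_nonneg fun i _ ↦ mul_self_nonneg _) fun h0 ↦ hx ?_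
      refine fderiv_eval_eq_zero_iff.2 fun i ↦ ?_
      exact mul_self_eq_zero.1 ((Finset.sum_eq_zero_iff_of_nonneg
        fun i _ ↦ mul_self_nonneg _).1 h0.symm i (Finset.mem_univ i)))
    hK hU
    (fun x hx v hv ↦ hnd x (fderiv_eval_eq_zero_iff.1 hx) v fun i ↦ by
      rw [← fderiv_fderiv_eval_apply, hv]; rfl) hfin
  refine h.trans ?_
  rw [Module.finrank_fintype_fun_eq_card]
  refine Nat.cast_le.2 (Nat.mul_le_mul_left _ (hcard _ fun x hx ↦ ?_))
  simpa using hx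

/-- Approximation of the complement of a real hypersurface from inside by a bounded
superlevel set with nondegenerate critical points. -/
lemma exists_nondegenerate_approx {f : MvPolynomial σ ℝ} {D : ℕ} (hD : f.totalDegree ≤ D)
    {K : Set (σ → ℝ)} (hK : IsCompact K) (hfK : ∀ x ∈ K, eval x f ≠ 0) :
    ∃ p : MvPolynomial σ ℝ, p.totalDegree ≤ 2 * D + 2 ∧ IsCompact {x | 0 ≤ eval x p} ∧
      (∀ x, 0 < eval x p → eval x f ≠ 0) ∧ (∀ x ∈ K, 0 < eval x p) ∧
      ∀ x, (∀ i, eval x (pderiv i p) = 0) → ∀ v : σ → ℝ,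
        (∀ i, ∑ j, eval x (pderiv j (pderiv i p)) * v j = 0) → v = 0 := by
  classical
  let N : (σ → ℝ) → ℝ := fun x ↦ 1 + ∑ i, x i ^ 2
  have hN1 (x) : 1 ≤ N x := le_add_of_nonneg_right (Finset.sum_nonneg fun i _ ↦ sq_nonneg _)
  have hNc : Continuous N := by fun_prop
  have hfc : Continuous fun x ↦ eval x f := MvPolynomial.continuous_eval f
  obtain ⟨ε, hε, hεK⟩ : ∃ ε, 0 < ε ∧ ∀ x ∈ K, 2 * ε * N x ^ (D + 1) < eval x f ^ 2 := by
    rcases K.eq_empty_or_nonempty with rfl | hne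
    · exact ⟨1, one_pos, by simp⟩
    obtain ⟨m, hm, hmin⟩ := hK.exists_isMinOn hne (f := fun x ↦ eval x f ^ 2 / N x ^ (D + 1))
      (Continuous.continuousOn ((hfc.pow 2).div (hNc.pow _)
        fun x ↦ (pow_pos (one_pos.trans_le (hN1 x)) _).ne'))
    have hpos : 0 < eval m f ^ 2 / N m ^ (D + 1) :=
      div_pos (sq_pos_of_ne_zero (hfK m hm)) (pow_pos (one_pos.trans_le (hN1 m)) _)
    refine ⟨eval m f ^ 2 / N m ^ (D + 1) / 3, by positivity, fun x hx ↦ ?_⟩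
    have hx0 : 0 < N x ^ (D + 1) := pow_pos (one_pos.trans_le (hN1 x)) _
    refine (lt_div_iff₀ hx0).1 (lt_of_lt_of_le ?_ (hmin hx))
    linarith
  set n := Fintype.card σ
  set P : MvPolynomial σ ℝ := 1 + ∑ i, X i ^ 2
  obtain ⟨a, ha, hnd⟩ := exists_forall_nondegenerate (f ^ 2 - C ε * P ^ (D + 1)) 
    (δ := ε / (n + 1)) (by positivity)
  set p := f ^ 2 - C ε * P ^ (D + 1) - ∑ k, C (a k) * X k
  have hp (x) : eval x p = eval x f ^ 2 - ε * N x ^ (D + 1) - ∑ k, a k * x k := by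
    simp [p, P, N]
  have hlin (x) : |∑ k, a k * x k| ≤ ε / 2 * N x ^ (D + 1) := by
    have h1 : |∑ k, a k * x k| ≤ n * (ε / (n + 1) * (N x / 2)) := by
      refine (Finset.abs_sum_le_sum_abs _ _).trans ?_
      refine (Finset.sum_le_card_nsmul _ _ (ε / (n + 1) * (N x / 2)) fun k _ ↦ ?_).trans_eq
        (by simp [n])
      rw [abs_mul]
      refine mul_le_mul (ha k).le ?_ (abs_nonneg _) (by positivity)
      have h3 : x k ^ 2 ≤ ∑ j, x j ^ 2 :=
        Finset.single_le_sum (fun j _ ↦ sq_nonneg (x j)) (Finset.mem_univ k)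
      simp only [N]
      nlinarith [sq_nonneg (|x k| - 1), sq_abs (x k)]
    have h2 : n * (ε / (n + 1)) ≤ ε := by
      rw [mul_div_assoc', div_le_iff₀ (by positivity)]
      linarith
    have h3 : N x ≤ N x ^ (D + 1) := le_self_pow₀ (hN1 x) (by simp)
    nlinarith [mul_le_mul_of_nonneg_right h2 (zero_le_one.trans (hN1 x)),
      mul_le_mul_of_nonneg_left h3 hε.le]
  have hup (x) : eval x p ≤ eval x f ^ 2 - ε / 2 * N x ^ (D + 1) := by
    rw [hp]; linarith [neg_le_of_abs_le (hlin x)]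
  refine ⟨p, ?_, ?_, fun x hx h0 ↦ ?_, fun x hx ↦ ?_, hnd⟩
  · refine (totalDegree_sub _ _).trans (max_le ((totalDegree_sub _ _).trans (max_le ?_ ?_)) ?_)
    · exact (totalDegree_pow _ _).trans (by omega)
    · refine (totalDegree_mul _ _).trans ?_
      rw [totalDegree_C, zero_add]
      have hP : P.totalDegree ≤ 2 := (totalDegree_add _ _).trans <| max_le (by simp) <|
        totalDegree_finsetSum_le fun i _ ↦ by simp
      exact (totalDegree_pow _ _).trans ((Nat.mul_le_mul_left _ hP).trans (by omega))
    · refine totalDegree_finsetSum_le fun i _ ↦ (totalDegree_mul _ _).trans ?_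
      simp
  · obtain ⟨c, hc⟩ := sq_eval_le f hD
    refine Metric.isCompact_of_isClosed_isBounded
      (isClosed_le continuous_const (MvPolynomial.continuous_eval p)) ?_
    refine (Metric.isBounded_closedBall (x := (0 : σ → ℝ)) (r := 2 * c / ε)).subset fun x hx ↦ ?_
    have hx : 0 ≤ eval x p := hx
    have h1 : ε / 2 * N x ^ (D + 1) ≤ c * N x ^ D := by linarith [hup x, hc x]
    have hpos : 0 < N x ^ D := pow_pos (one_pos.trans_le (hN1 x)) _
    have h2 : N x ≤ 2 * c / ε := by
      rw [le_div_iff₀ hε]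
      refine le_of_mul_le_mul_right ?_ hpos
      rw [pow_succ] at h1
      linarith
    rw [mem_closedBall_zero_iff]
    refine (pi_norm_le_iff_of_nonneg (zero_le_one.trans ((hN1 x).trans h2))).2 fun i ↦ ?_
    have h3 : x i ^ 2 ≤ ∑ j, x j ^ 2 :=
      Finset.single_le_sum (fun j _ ↦ sq_nonneg (x j)) (Finset.mem_univ i)
    have h4 : 1 + ∑ j, x j ^ 2 ≤ 2 * c / ε := h2
    rw [Real.norm_eq_abs]
    refine abs_le.2 ⟨?_, ?_⟩ <;> nlinarith [sq_nonneg (x i - 1), sq_nonneg (x i + 1)]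
  · have := hup x
    rw [h0] at this
    have h1 : 0 < ε / 2 * N x ^ (D + 1) := mul_pos (by linarith) (pow_pos (one_pos.trans_le (hN1 x)) _)
    linarith
  · rw [hp]
    have h1 : 0 < ε * N x ^ (D + 1) := mul_pos hε (pow_pos (one_pos.trans_le (hN1 x)) _)
    linarith [hεK x hx, le_of_abs_le (hlin x)]

end MvPolynomial

open PathChain MvPolynomial in
lemma rank_singularHomology_compl_zeroSet_le {D : ℕ} (hD : 1 ≤ D) {f : MvPolynomial (Fin 3) ℝ}
    (hf : f.totalDegree ≤ D) :
    Module.rank (ZMod 2) ((singularHomologyFunctor (ZMod 2) 1).obj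
      (TopCat.of ((ZeroSet f)ᶜ : Set (Fin 3 → ℝ)))) ≤ (6000 * D ^ 3 : ℕ) := by
  refine (rank_singularHomology_le _).trans (rank_le_of_forall_finset fun S hS ↦ ?_)
  obtain ⟨K, -, hK, hSK⟩ := exists_isCompact_classesIn S hS
  obtain ⟨p, hp, hpc, hpU, hpK, hnd⟩ := exists_nondegenerate_approx hf
    (hK.image continuous_subtype_val) (by rintro _ ⟨x, -, rfl⟩; exact x.2)
  refine ⟨classesOn (ZeroSet f)ᶜ {x | 0 < eval x p}, ?_, hSK.trans (classesIn_mono fun x hx ↦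
    hpK x (Set.mem_image_of_mem _ hx))⟩
  refine (MvPolynomial.rank_superlevel_le (d := 2 * D + 1) hp hpc (fun x hx ↦ hpU x hx)
    hnd).trans (Nat.cast_le.2 ?_)
  rw [Fintype.card_fin]
  calc 3 * 2 * (3 * (2 * D + 1) + 1) ^ 3 ≤ 3 * 2 * (10 * D) ^ 3 := by gcongr; omega
    _ = 6000 * D ^ 3 := by ring

/-- There is an absolute constant `C` such that for every nonzero
polynomial `f ∈ ℝ[x,y,z]` of degree at most `D` (with `D ≥ 1`), the first Betti number
of `ℝ³ \ Z(f)` with `ℤ/2` coefficients is at most `C·D³`: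
`dim_{ℤ/2} H₁(ℝ³ \ Z(f); ℤ/2) ≤ C·D³`. -/
theorem first_betti_number_complement_le :
    ∃ C : ℕ, 0 < C ∧
      ∀ (D : ℕ), 1 ≤ D →
        ∀ f : MvPolynomial (Fin 3) ℝ, f ≠ 0 → f.totalDegree ≤ D →
          Module.rank (ZMod 2)
              ((singularHomologyFunctor (ZMod 2) 1).obj
                (TopCat.of ((ZeroSet f)ᶜ : Set (Fin 3 → ℝ))))
            ≤ (C * D ^ 3 : ℕ) := by
  exact ⟨6000, by norm_num, fun D hD f _ hf ↦ rank_singularHomology_compl_zeroSet_le hD hf⟩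
end

section
/- Let Δ₁ and Δ₂ be disjoint non-vertical triangles in ℝ³, and let o₁ ⊆ Δ₁ and o₂ ⊆ Δ₂ be arbitrary subsets. If ℓ and ℓ' are vertical lines each of which meets both o₁ and o₂, then the z-coordinate of ℓ ∩ o₁ is smaller than the z-coordinate of ℓ ∩ o₂ if and only if the z-coordinate of ℓ' ∩ o₁ is smaller than the z-coordinate of ℓ' ∩ o₂. In particular, the depth relation between pieces of pairwise disjoint triangles is independent of the choice of witnessing vertical line. -/
/-- A set in `ℝ³` is a non-vertical triangle if it is the convex hull of three affinely
independent points whose spanning plane is not parallel to the `z`-axis, i.e. the direction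
of the affine span does not contain the vertical vector `(0,0,1)`. -/
def IsNonVerticalTriangle (s : Set (Fin 3 → ℝ)) : Prop :=
  ∃ a b c : Fin 3 → ℝ, AffineIndependent ℝ ![a, b, c] ∧
    s = convexHull ℝ {a, b, c} ∧
    (![0, 0, 1] : Fin 3 → ℝ) ∉ (affineSpan ℝ ({a, b, c} : Set (Fin 3 → ℝ))).direction

/-- Disjoint convex sets in `ℝ³` cannot change their vertical order from one vertical line
to another: otherwise they would meet above the segment joining the two lines. -/
theorem Convex.lt_of_lt_of_disjoint_of_vertical {s t : Set (Fin 3 → ℝ)}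
    (hs : Convex ℝ s) (ht : Convex ℝ t) (hst : Disjoint s t) {p₁ p₂ q₁ q₂ : Fin 3 → ℝ}
    (hp₁ : p₁ ∈ s) (hp₂ : p₂ ∈ t) (hq₁ : q₁ ∈ s) (hq₂ : q₂ ∈ t)
    (hpx : p₁ 0 = p₂ 0) (hpy : p₁ 1 = p₂ 1) (hqx : q₁ 0 = q₂ 0) (hqy : q₁ 1 = q₂ 1)
    (hp : p₁ 2 < p₂ 2) : q₁ 2 < q₂ 2 := by
  by_contra! hq
  have hd : 0 < p₂ 2 - p₁ 2 := sub_pos.2 hp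
  have he : 0 ≤ q₁ 2 - q₂ 2 := sub_nonneg.2 hq
  obtain ⟨d, hd_eq⟩ : ∃ d, d = p₂ 2 - p₁ 2 := ⟨_, rfl⟩
  obtain ⟨e, he_eq⟩ : ∃ e, e = q₁ 2 - q₂ 2 := ⟨_, rfl⟩
  rw [← hd_eq] at hd
  rw [← he_eq] at he
  have hde : 0 < e + d := by positivity
  have hsum : e / (e + d) + d / (e + d) = 1 := by field_simp
  have hα : 0 ≤ e / (e + d) := by positivity
  have hβ : 0 ≤ d / (e + d) := by positivity
  refine Set.disjoint_left.1 hst (hs hp₁ hq₁ hα hβ hsum) ?_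
  convert ht hp₂ hq₂ hα hβ hsum using 1
  ext i
  fin_cases i
  · simp [hpx, hqx]
  · simp [hpy, hqy]
  · have h₁ : p₂ 2 = p₁ 2 + d := by linarith
    have h₂ : q₁ 2 = q₂ 2 + e := by linarith
    simp only [Fin.reduceFinMk, Pi.add_apply, Pi.smul_apply, smul_eq_mul, h₁, h₂]
    ring

theorem IsNonVerticalTriangle.convex {s : Set (Fin 3 → ℝ)} (h : IsNonVerticalTriangle s) :
    Convex ℝ s := by
  obtain ⟨a, b, c, -, rfl, -⟩ := h
  exact convex_convexHull ℝ _

/-- For pieces of two disjoint non-vertical triangles, the comparison of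
`z`-coordinates along a vertical line meeting both pieces does not depend on the choice of
the vertical line: if `p₁ ∈ o₁`, `p₂ ∈ o₂` lie on one common vertical line and
`q₁ ∈ o₁`, `q₂ ∈ o₂` lie on another common vertical line, then `p₁` is below `p₂`
iff `q₁` is below `q₂`. -/
theorem depth_relation_well_defined
    (Δ₁ Δ₂ : Set (Fin 3 → ℝ))
    (h₁ : IsNonVerticalTriangle Δ₁) (h₂ : IsNonVerticalTriangle Δ₂)
    (hdisj : Disjoint Δ₁ Δ₂)
    (o₁ o₂ : Set (Fin 3 → ℝ)) (ho₁ : o₁ ⊆ Δ₁) (ho₂ : o₂ ⊆ Δ₂)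
    (p₁ p₂ q₁ q₂ : Fin 3 → ℝ)
    (hp₁ : p₁ ∈ o₁) (hp₂ : p₂ ∈ o₂) (hq₁ : q₁ ∈ o₁) (hq₂ : q₂ ∈ o₂)
    -- `p₁` and `p₂` lie on a common vertical line `ℓ`:
    (hpx : p₁ 0 = p₂ 0) (hpy : p₁ 1 = p₂ 1)
    -- `q₁` and `q₂` lie on a common vertical line `ℓ'`:
    (hqx : q₁ 0 = q₂ 0) (hqy : q₁ 1 = q₂ 1) :
    (p₁ 2 < p₂ 2 ↔ q₁ 2 < q₂ 2) := by
  have c₁ := h₁.convex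
  have c₂ := h₂.convex
  exact ⟨c₁.lt_of_lt_of_disjoint_of_vertical c₂ hdisj (ho₁ hp₁) (ho₂ hp₂) (ho₁ hq₁) (ho₂ hq₂)
      hpx hpy hqx hqy,
    c₁.lt_of_lt_of_disjoint_of_vertical c₂ hdisj (ho₁ hq₁) (ho₂ hq₂) (ho₁ hp₁) (ho₂ hp₂)
      hqx hqy hpx hpy⟩
end

section
/- There exists an absolute constant C such that the following holds: for every nonzero polynomial f ∈ ℝ[x,y,z] of degree at most D (D ≥ 1) and every plane h ⊆ ℝ³ not contained in Z(f), the number of connected components of ℝ³ \ Z(f) that intersect h is at most C·D². -/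
open MvPolynomial in
theorem finrank_restrictTotalDegree_two (K : Type*) [Field K] (k : ℕ) :
    2 * Module.finrank K (restrictTotalDegree (Fin 2) K k) = (k + 1) * (k + 2) := by
  rw [restrictTotalDegree, Module.finrank_eq_nat_card_basis (basisRestrictSupport K _)]
  have hset : {n : Fin 2 →₀ ℕ | (n.sum fun _ e => e) ≤ k} =
      ((Finset.range (k + 1)).biUnion fun d =>
        (Finset.univ : Finset (Fin 2)).finsuppAntidiag d : Finset (Fin 2 →₀ ℕ)) := by
    ext n
    simp [Finsupp.sum_fintype]
  rw [hset, SetLike.coe_sort_coe, Nat.card_eq_fintype_card, Fintype.card_coe, Finset.card_biUnion]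
  · simp only [Finset.card_finsuppAntidiag_nat_eq_choose, Finset.card_univ, Fintype.card_fin]
    induction k with
    | zero => simp
    | succ k ih =>
      rw [Finset.sum_range_succ, mul_add, ih (by
        ext n
        simp [Finsupp.sum_fintype])]
      rw [show 2 + (k + 1) - 1 = (k + 1) + 1 by omega, Nat.choose_succ_self_right]
      ring
  · intro a _ b _ hab
    rw [Function.onFun, Finset.disjoint_left]
    intro n hn hn'
    simp only [Finset.mem_finsuppAntidiag] at hn hn'
    exact hab (hn.1.symm.trans hn'.1)

open MvPolynomial in
theorem MvPolynomial.exists_eval_eq_ite {σ K : Type*} [Field K] (S : Finset (σ → K)) (p : σ → K) :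
    ∃ L : MvPolynomial σ K, eval p L = 1 ∧ ∀ q ∈ S, q ≠ p → eval q L = 0 := by
  classical
  induction S using Finset.induction_on with
  | empty => exact ⟨1, by simp⟩
  | insert q S _ ih =>
    obtain ⟨L, hL, hS⟩ := ih
    by_cases hq : q = p
    · refine ⟨L, hL, fun r hr hrp => ?_⟩
      rcases Finset.mem_insert.1 hr with rfl | hr
      · exact absurd hq hrp
      · exact hS r hr hrp
    · obtain ⟨i, hi⟩ := Function.ne_iff.1 hq
      have hi' : p i - q i ≠ 0 := sub_ne_zero.2 (Ne.symm hi)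
      refine ⟨L * ((X i - C (q i)) * C (p i - q i)⁻¹), by simp [hL, hi'], fun r hr hrp => ?_⟩
      rcases Finset.mem_insert.1 hr with rfl | hr
      · simp
      · simp [hS r hr hrp]

theorem Submodule.finrank_map_of_injective {K V W : Type*} [Field K] [AddCommGroup V] [Module K V]
    [AddCommGroup W] [Module K W] (p : Submodule K V) {f : V →ₗ[K] W}
    (hf : Function.Injective f) : Module.finrank K (p.map f) = Module.finrank K p :=
  (p.equivMapOfInjective f hf).finrank_eq.symm

open MvPolynomial in
/-- The weak form of Bézout's theorem in the affine plane. -/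
theorem card_common_zeros_le {K : Type*} [Field K] {P Q : MvPolynomial (Fin 2) K} (hP : P ≠ 0)
    (hQ : Q ≠ 0) (hPQ : IsRelPrime P Q) (S : Finset (Fin 2 → K))
    (hSP : ∀ p ∈ S, eval p P = 0) (hSQ : ∀ p ∈ S, eval p Q = 0) :
    S.card ≤ P.totalDegree * Q.totalDegree := by
  classical
  set m := P.totalDegree
  set n := Q.totalDegree
  choose L hL1 hL0 using fun p : Fin 2 → K => exists_eval_eq_ite S p
  set j := S.sup fun p => (L p).totalDegree
  let R : ℕ → Submodule K (MvPolynomial (Fin 2) K) := restrictTotalDegree (Fin 2) K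
  have hR : ∀ k, 2 * Module.finrank K (R k) = (k + 1) * (k + 2) :=
    finrank_restrictTotalDegree_two K
  have hmulinj : ∀ A : MvPolynomial (Fin 2) K, A ≠ 0 →
      Function.Injective (LinearMap.mulLeft K A) := fun A hA x y h => mul_left_cancel₀ hA h
  let s := (R (j + n)).map (LinearMap.mulLeft K P)
  let t := (R (j + m)).map (LinearMap.mulLeft K Q)
  have hs : Module.finrank K s = Module.finrank K (R (j + n)) :=
    Submodule.finrank_map_of_injective _ (hmulinj P hP)
  have ht : Module.finrank K t = Module.finrank K (R (j + m)) :=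
    Submodule.finrank_map_of_injective _ (hmulinj Q hQ)
  have hinf : Module.finrank K (s ⊓ t : Submodule K _) ≤ Module.finrank K (R j) := by
    rw [← Submodule.finrank_map_of_injective (R j) (hmulinj (P * Q) (mul_ne_zero hP hQ))]
    refine Submodule.finrank_mono ?_
    rintro _ ⟨⟨A, hA, rfl⟩, ⟨B, hB, hAB⟩⟩
    simp only [LinearMap.mulLeft_apply] at hAB ⊢
    obtain ⟨E, rfl⟩ : Q ∣ A := hPQ.symm.dvd_of_dvd_mul_left ⟨B, hAB.symm⟩
    refine ⟨E, ?_, by simp⟩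
    by_cases hE : E = 0
    · simp [hE]
    · have := (mem_restrictTotalDegree _ _ _).1 hA
      rw [totalDegree_mul_of_isDomain hQ hE] at this
      exact (mem_restrictTotalDegree _ _ _).2 (by omega)
  let ev : R (j + m + n) →ₗ[K] (S → K) :=
    (LinearMap.pi fun p : S => (aeval (p : Fin 2 → K)).toLinearMap) ∘ₗ (R (j + m + n)).subtype
  have hev : ∀ x p, ev x p = eval (p : Fin 2 → K) (x : MvPolynomial (Fin 2) K) := by
    intro x p
    simp [ev, aeval_eq_eval]
  have hsurj : LinearMap.range ev = ⊤ := by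
    rw [LinearMap.range_eq_top]
    intro v
    refine ⟨⟨∑ p : S, v p • L p, Submodule.sum_mem _ fun p _ => Submodule.smul_mem _ _ ?_⟩, ?_⟩
    · have : (L p).totalDegree ≤ j := Finset.le_sup (f := fun p => (L p).totalDegree) p.2
      exact (mem_restrictTotalDegree _ _ _).2 (by omega)
    · ext q
      rw [hev]
      simp only [map_sum, smul_eval]
      rw [Finset.sum_eq_single q]
      · rw [hL1, mul_one]
      · intro p _ hpq
        rw [hL0 p q q.2 (fun h => hpq (Subtype.ext h.symm)), mul_zero]
      · simp
  have hrank := LinearMap.finrank_range_add_finrank_ker ev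
  rw [hsurj, finrank_top, Module.finrank_fintype_fun_eq_card, Fintype.card_coe] at hrank
  have hsup : Module.finrank K (s ⊔ t : Submodule K _) ≤ Module.finrank K (LinearMap.ker ev) := by
    rw [← Submodule.finrank_map_of_injective (LinearMap.ker ev)
      (R (j + m + n)).injective_subtype]
    refine Submodule.finrank_mono (sup_le ?_ ?_)
    · rintro _ ⟨A, hA, rfl⟩
      have hA' := (mem_restrictTotalDegree _ _ _).1 hA
      refine ⟨⟨P * A, (mem_restrictTotalDegree _ _ _).2
        ((totalDegree_mul _ _).trans (by omega))⟩, ?_, rfl⟩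
      refine LinearMap.mem_ker.2 (funext fun p => ?_)
      rw [hev]
      simp [hSP p p.2]
    · rintro _ ⟨A, hA, rfl⟩
      have hA' := (mem_restrictTotalDegree _ _ _).1 hA
      refine ⟨⟨Q * A, (mem_restrictTotalDegree _ _ _).2
        ((totalDegree_mul _ _).trans (by omega))⟩, ?_, rfl⟩
      refine LinearMap.mem_ker.2 (funext fun p => ?_)
      rw [hev]
      simp [hSQ p p.2]
  have hadd := Submodule.finrank_sup_add_finrank_inf_eq s t
  have h1 := hR j
  have h2 := hR (j + n)
  have h3 := hR (j + m)
  have h4 := hR (j + m + n)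
  nlinarith

open MvPolynomial in
theorem finite_not_isRelPrime_add_C {σ K : Type*} [Field K] {P : MvPolynomial σ K} (hP : P ≠ 0)
    (Q : MvPolynomial σ K) : {b : K | ¬ IsRelPrime P (Q + C b)}.Finite := by
  induction P using UniqueFactorizationMonoid.induction_on_prime with
  | h₁ => exact absurd rfl hP
  | h₂ u hu =>
    convert Set.finite_empty
    ext b
    simpa using hu.isRelPrime_left
  | h₃ a p ha hp ih =>
    have hsub : {b : K | p ∣ Q + C b}.Subsingleton := by
      intro b hb c hc
      by_contra hbc
      have h := dvd_sub hb hc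
      rw [add_sub_add_left_eq_sub, ← C_sub] at h
      exact hp.not_isUnit (isUnit_of_dvd_unit h ((sub_ne_zero.2 hbc).isUnit.map C))
    refine ((ih ha).union hsub.finite).subset fun b hb => ?_
    by_contra h
    simp only [Set.mem_union, Set.mem_ofPred_eq, not_or, not_not] at h
    exact hb (IsRelPrime.mul_left (hp.irreducible.isRelPrime_iff_not_dvd.2 h.2) h.1)

theorem MvPolynomial.totalDegree_pderiv_le_s13 {σ R : Type*} [CommSemiring R] (i : σ)
    (p : MvPolynomial σ R) : (pderiv i p).totalDegree ≤ p.totalDegree - 1 := by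
  rw [totalDegree, Finset.sup_le_iff]
  intro m hm
  rw [mem_support_iff, coeff_pderiv] at hm
  have h := le_totalDegree (mem_support_iff.2 (left_ne_zero_of_mul hm))
  rw [Finsupp.sum_add_index' (fun _ => rfl) (fun _ _ _ => rfl), Finsupp.sum_single_index rfl] at h
  omega

open MvPolynomial in
theorem MvPolynomial.hasDerivAt_eval_update {σ : Type*} [DecidableEq σ] (p : MvPolynomial σ ℝ)
    (q : σ → ℝ) (i : σ) :
    HasDerivAt (fun s => eval (Function.update q i s) p) (eval q (pderiv i p)) (q i) := by
  induction p using MvPolynomial.induction_on with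
  | C a => simpa using hasDerivAt_const (q i) a
  | add p r hp hr => simpa using hp.fun_add hr
  | mul_X p j hp =>
    have hX : HasDerivAt (fun s => Function.update q i s j) (eval q (pderiv i (X j))) (q i) := by
      rcases eq_or_ne j i with rfl | hj
      · simpa using hasDerivAt_id' (q j)
      · simpa [pderiv_X_of_ne hj, hj] using hasDerivAt_const (q i) (q j)
    have := hp.fun_mul hX
    simp only [Function.update_eq_self, Derivation.leibniz, smul_eq_mul, map_add, map_mul, eval_X]
      at this ⊢
    rwa [mul_comm (q j), add_comm]

open MvPolynomial in
theorem MvPolynomial.totalDegree_aeval_le {σ τ R : Type*} [CommSemiring R]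
    {y : σ → MvPolynomial τ R} (hy : ∀ i, (y i).totalDegree ≤ 1) (p : MvPolynomial σ R) :
    (aeval y p).totalDegree ≤ p.totalDegree := by
  rw [aeval_def, eval₂_eq]
  refine totalDegree_finsetSum_le fun d hd => (totalDegree_mul _ _).trans ?_
  rw [algebraMap_eq, totalDegree_C, zero_add]
  refine (totalDegree_finsetProd _ _).trans ((Finset.sum_le_sum fun i _ => ?_).trans
    (le_totalDegree hd))
  exact (totalDegree_pow _ _).trans (by simpa using Nat.mul_le_mul_left (d i) (hy i))

open MvPolynomial in
/-- At an interior maximum of the absolute value of a polynomial, where the polynomial does not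
vanish, all its partial derivatives vanish. -/
theorem MvPolynomial.eval_pderiv_eq_zero_of_abs_le {σ : Type*} {H : MvPolynomial σ ℝ}
    {V : Set (σ → ℝ)} (hV : IsOpen V) {q : σ → ℝ} (hq : q ∈ V) (hq0 : eval q H ≠ 0)
    (hmax : ∀ x ∈ V, |eval x H| ≤ |eval q H|) (i : σ) : eval q (pderiv i H) = 0 := by
  classical
  have hd := (hasDerivAt_eval_update H q i).fun_pow 2
  have hloc : IsLocalMax (fun s => eval (Function.update q i s) H ^ 2) (q i) := by
    have hc : Continuous fun s => Function.update q i s := continuous_const.update i continuous_id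
    have hmem : (fun s => Function.update q i s) ⁻¹' V ∈ nhds (q i) :=
      (hV.preimage hc).mem_nhds (by simpa using hq)
    filter_upwards [hmem] with s hs
    simpa using sq_le_sq.2 (hmax _ hs)
  have := hloc.hasDerivAt_eq_zero hd
  simpa [hq0] using this

open MvPolynomial in
theorem exists_perturbation_isRelPrime {K σ : Type*} [Field K] (P Q : MvPolynomial σ K) {I : Set K}
    (hI : I.Infinite) : ∃ a ∈ I, ∃ b ∈ I,
      P + C a ≠ 0 ∧ Q + C b ≠ 0 ∧ IsRelPrime (P + C a) (Q + C b) := by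
  have hfin : ∀ A : MvPolynomial σ K, {a : K | A + C a = 0}.Finite := fun A =>
    Set.Subsingleton.finite fun a ha b hb =>
      C_injective σ K (add_left_cancel (ha.trans hb.symm))
  obtain ⟨a, haI, ha⟩ := hI.exists_notMem_finite (hfin P)
  obtain ⟨b, hbI, hb⟩ := hI.exists_notMem_finite
    ((hfin Q).union (finite_not_isRelPrime_add_C ha Q))
  simp only [Set.mem_union, Set.mem_ofPred_eq, not_or, not_not] at hb
  exact ⟨a, haI, b, hbI, ha, hb⟩

open MvPolynomial in
/-- A bound for the number of disjoint open regions of the plane bounded by an algebraic curve. -/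
theorem card_regions_le {ι : Type*} (T : Finset ι) (U : ι → Set (Fin 2 → ℝ))
    (g : MvPolynomial (Fin 2) ℝ) (D : ℕ) (hg : g.totalDegree ≤ D)
    (hopen : ∀ i ∈ T, IsOpen (U i)) (hne : ∀ i ∈ T, (U i).Nonempty)
    (hdisj : ∀ i ∈ T, ∀ j ∈ T, i ≠ j → Disjoint (U i) (U j))
    (hU : ∀ i ∈ T, ∀ x ∈ U i, eval x g ≠ 0)
    (hfr : ∀ i ∈ T, ∀ x ∈ frontier (U i), eval x g = 0) : T.card ≤ (D + 1) ^ 2 := by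
  classical
  choose! p hp using hne
  obtain ⟨R, hR0, hR⟩ : ∃ R : ℝ, 0 < R ∧ ∀ i ∈ T, p i 0 ^ 2 + p i 1 ^ 2 < R := by
    have h : ∀ᶠ R : ℝ in Filter.atTop, ∀ i ∈ T, p i 0 ^ 2 + p i 1 ^ 2 < R :=
      (Filter.eventually_all_finset T).2 fun i _ => Filter.eventually_gt_atTop _
    exact ((Filter.eventually_gt_atTop 0).and h).exists
  set G : MvPolynomial (Fin 2) ℝ := g * (C R - X 0 ^ 2 - X 1 ^ 2) with hG
  have hGe : ∀ x, eval x G = eval x g * (R - x 0 ^ 2 - x 1 ^ 2) := fun x => by simp [hG]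
  have hGdeg : G.totalDegree ≤ D + 2 := by
    refine (totalDegree_mul _ _).trans (add_le_add hg ?_)
    refine (totalDegree_sub _ _).trans (max_le ((totalDegree_sub _ _).trans (max_le ?_ ?_)) ?_) <;>
      simp [totalDegree_X_pow]
  obtain ⟨ε, hε, hεp⟩ : ∃ ε : ℝ, 0 < ε ∧ ∀ i ∈ T, ε < |eval (p i) G| := by
    have h : ∀ᶠ ε : ℝ in nhdsWithin 0 (Set.Ioi 0), ∀ i ∈ T, ε < |eval (p i) G| := by
      refine (Filter.eventually_all_finset T).2 fun i hi =>
        nhdsWithin_le_nhds (eventually_lt_nhds ?_)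
      rw [abs_pos, hGe]
      exact mul_ne_zero (hU i hi _ (hp i hi)) (by linarith [hR i hi])
    have h' : ∀ᶠ ε : ℝ in nhdsWithin 0 (Set.Ioi 0), 0 < ε := self_mem_nhdsWithin
    exact (h'.and h).exists
  set B : Set (Fin 2 → ℝ) := {x | x 0 ^ 2 + x 1 ^ 2 < R}
  set B' : Set (Fin 2 → ℝ) := {x | x 0 ^ 2 + x 1 ^ 2 ≤ R}
  have hBopen : IsOpen B := isOpen_lt (by fun_prop) (by fun_prop)
  have hBclosed : IsClosed B' := isClosed_le (by fun_prop) (by fun_prop)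
  have hcoord : ∀ x ∈ B', ∀ j, |x j| ≤ R + 1 := by
    intro x hx j
    have hx : x 0 ^ 2 + x 1 ^ 2 ≤ R := hx
    refine abs_le_of_sq_le_sq ?_ (by linarith)
    fin_cases j <;> simp <;> nlinarith [sq_nonneg (x 0), sq_nonneg (x 1)]
  have hBcompact : IsCompact B' := by
    refine (isCompact_univ_pi fun _ : Fin 2 => isCompact_Icc (a := -(R + 1)) (b := R + 1)
      ).of_isClosed_subset hBclosed fun x hx j _ => abs_le.1 (hcoord x hx j)
  obtain ⟨a, ha, b, hb, hP, hQ, hPQ⟩ := exists_perturbation_isRelPrime (pderiv 0 G) (pderiv 1 G)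
    (Set.Ioo_infinite (show (0 : ℝ) < ε / (4 * (R + 1)) by positivity))
  set H : MvPolynomial (Fin 2) ℝ := G + (C a * X 0 + C b * X 1) with hH
  have hsmall : ∀ x ∈ B', |eval x H - eval x G| < ε / 2 := by
    intro x hx
    have h0 := hcoord x hx 0
    have h1 := hcoord x hx 1
    have hlt : ∀ c ∈ Set.Ioo 0 (ε / (4 * (R + 1))), ∀ y : ℝ, |y| ≤ R + 1 → |c * y| < ε / 4 := by
      intro c hc y hy
      rw [abs_mul, abs_of_pos hc.1]
      calc c * |y| ≤ c * (R + 1) := mul_le_mul_of_nonneg_left hy hc.1.le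
        _ < ε / (4 * (R + 1)) * (R + 1) := mul_lt_mul_of_pos_right hc.2 (by linarith)
        _ = ε / 4 := by field_simp
    have he : eval x H - eval x G = a * x 0 + b * x 1 := by simp [hH]
    rw [he]
    have := abs_add_le (a * x 0) (b * x 1)
    linarith [hlt a ha _ h0, hlt b hb _ h1]
  have hH0 : pderiv 0 H = pderiv 0 G + C a := by simp [hH, pderiv_X]
  have hH1 : pderiv 1 H = pderiv 1 G + C b := by simp [hH, pderiv_X]
  have hcrit : ∀ i ∈ T, ∃ q ∈ U i, eval q (pderiv 0 H) = 0 ∧ eval q (pderiv 1 H) = 0 := by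
    intro i hi
    have hVopen : IsOpen (U i ∩ B) := (hopen i hi).inter hBopen
    have hsub : closure (U i ∩ B) ⊆ B' :=
      closure_minimal (fun x hx => le_of_lt (show x 0 ^ 2 + x 1 ^ 2 < R from hx.2)) hBclosed
    have hpV : p i ∈ U i ∩ B := ⟨hp i hi, hR i hi⟩
    obtain ⟨q, hqK, hqmax⟩ := (hBcompact.of_isClosed_subset isClosed_closure hsub).exists_isMaxOn
      ⟨p i, subset_closure hpV⟩ (f := fun x => |eval x H|) (continuous_eval H).abs.continuousOn
    have hmax : ∀ x ∈ U i ∩ B, |eval x H| ≤ |eval q H| := fun x hx => hqmax (subset_closure hx)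
    have hqbig : ε / 2 < |eval q H| := by
      have h1 := hmax _ hpV
      have h2 := hsmall _ (hsub (subset_closure hpV))
      have h3 := hεp i hi
      have h4 := abs_sub_abs_le_abs_sub (eval (p i) G) (eval (p i) H)
      rw [abs_sub_comm] at h4
      linarith
    have hqG : eval q G ≠ 0 := by
      intro h
      have := hsmall q (hsub hqK)
      rw [h, sub_zero] at this
      linarith
    rw [hGe] at hqG
    have hqU : q ∈ U i := by
      by_contra hq
      refine left_ne_zero_of_mul hqG (hfr i hi q ?_)
      rw [(hopen i hi).frontier_eq]
      exact ⟨closure_mono Set.inter_subset_left hqK, hq⟩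
    have hqB : q ∈ B := by
      have hle : q 0 ^ 2 + q 1 ^ 2 ≤ R := hsub hqK
      refine lt_of_le_of_ne hle fun h => right_ne_zero_of_mul hqG ?_
      rw [← h]
      ring
    have hq0 : eval q H ≠ 0 := abs_pos.1 (by linarith)
    exact ⟨q, hqU, eval_pderiv_eq_zero_of_abs_le hVopen ⟨hqU, hqB⟩ hq0 hmax 0,
      eval_pderiv_eq_zero_of_abs_le hVopen ⟨hqU, hqB⟩ hq0 hmax 1⟩
  choose! q hqU hq0 hq1 using hcrit
  have hinj : Set.InjOn q T := by
    intro i hi j hj hij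
    by_contra h
    exact Set.disjoint_left.1 (hdisj i hi j hj h) (hqU i hi) (hij ▸ hqU j hj)
  rw [← Finset.card_image_of_injOn hinj]
  have hdeg : ∀ i c, (pderiv i G + C c).totalDegree ≤ D + 1 := by
    intro i c
    have := totalDegree_pderiv_le_s13 i G
    refine (totalDegree_add _ _).trans (max_le (by omega) ?_)
    simp
  refine (card_common_zeros_le hP hQ hPQ (T.image q) ?_ ?_).trans ?_
  · rw [← hH0]
    simpa using hq0
  · rw [← hH1]
    simpa using hq1
  · rw [sq]
    exact Nat.mul_le_mul (hdeg _ _) (hdeg _ _)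

open MvPolynomial in
/-- The restriction of a polynomial to the plane through `p` with directions `u 0` and `u 1`. -/
theorem exists_restrict_plane (f : MvPolynomial (Fin 3) ℝ) (p : Fin 3 → ℝ)
    (u : Fin 2 → Fin 3 → ℝ) : ∃ g : MvPolynomial (Fin 2) ℝ, g.totalDegree ≤ f.totalDegree ∧
      ∀ t, eval t g = eval (p + ∑ i, t i • u i) f := by
  refine ⟨aeval (fun k => C (p k) + ∑ i, X i * C (u i k)) f,
    totalDegree_aeval_le (fun k => ?_) f, fun t => ?_⟩
  · refine (totalDegree_add _ _).trans (max_le (by simp) (totalDegree_finsetSum_le fun i _ => ?_))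
    exact (totalDegree_mul _ _).trans (by simp)
  · rw [← aeval_eq_eval, ← aeval_eq_eval, ← AlgHom.comp_apply, comp_aeval]
    congr 2
    ext k
    simp

/-- There is an absolute constant `C` such that for every nonzero
polynomial `f ∈ ℝ[x,y,z]` of degree at most `D` (with `D ≥ 1`) and every plane
`h ⊆ ℝ³` (a two-dimensional affine subspace) not contained in `Z(f)`, the family of
connected components of `ℝ³ \ Z(f)` meeting `h` is finite, of cardinality at most
`C·D²`. -/
theorem card_components_meeting_plane_le :
    ∃ C : ℕ, 0 < C ∧
      ∀ (D : ℕ), 1 ≤ D →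
        ∀ f : MvPolynomial (Fin 3) ℝ, f ≠ 0 → f.totalDegree ≤ D →
          ∀ h : AffineSubspace ℝ (Fin 3 → ℝ),
            Module.finrank ℝ h.direction = 2 →
            ¬ ((h : Set (Fin 3 → ℝ)) ⊆ ZeroSet f) →
            ({s : Set (Fin 3 → ℝ) |
                (∃ x ∈ (ZeroSet f)ᶜ, s = connectedComponentIn (ZeroSet f)ᶜ x) ∧
                (s ∩ (h : Set (Fin 3 → ℝ))).Nonempty}).Finite ∧
            ({s : Set (Fin 3 → ℝ) |
                (∃ x ∈ (ZeroSet f)ᶜ, s = connectedComponentIn (ZeroSet f)ᶜ x) ∧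
                (s ∩ (h : Set (Fin 3 → ℝ))).Nonempty}).ncard ≤ C * D ^ 2 := by
  refine ⟨4, by norm_num, fun D hD f _ hfD h hdim hnot => ?_⟩
  rw [← Set.encard_le_coe_iff_finite_ncard_le]
  by_contra! hlt
  obtain ⟨T, hTS, hT⟩ := Set.exists_subset_encard_eq (Order.add_one_le_of_lt hlt)
  have hTfin : T.Finite := Set.finite_of_encard_le_coe (k := 4 * D ^ 2 + 1) (by simp [hT])
  lift T to Finset (Set (Fin 3 → ℝ)) using hTfin
  obtain ⟨p, hph, -⟩ := Set.not_subset.1 hnot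
  let e := Module.finBasisOfFinrankEq ℝ h.direction hdim
  obtain ⟨g, hgdeg, hg⟩ := exists_restrict_plane f p (fun i => e i)
  let φ : (Fin 2 → ℝ) → Fin 3 → ℝ := fun t => p + ∑ i, t i • (e i : Fin 3 → ℝ)
  have hφ : Continuous φ := by fun_prop
  have hφh : ∀ x ∈ h, ∃ t, φ t = x := by
    intro x hx
    refine ⟨e.repr ⟨x -ᵥ p, AffineSubspace.vsub_mem_direction hx hph⟩, ?_⟩
    have := congrArg Subtype.val (e.sum_repr ⟨x -ᵥ p, AffineSubspace.vsub_mem_direction hx hph⟩)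
    simp only [AddSubmonoidClass.coe_finsetSum, Submodule.coe_smul] at this
    change p + ∑ i, _ • (e i : Fin 3 → ℝ) = x
    rw [this, vsub_eq_sub, add_sub_cancel]
  set F := (ZeroSet f)ᶜ
  have hFopen : IsOpen F :=
    (isClosed_eq (MvPolynomial.continuous_eval f) continuous_const).isOpen_compl
  have hcomp : ∀ s ∈ T, ∃ x ∈ F, s = connectedComponentIn F x := fun s hs => (hTS hs).1
  have hsopen : ∀ s ∈ T, IsOpen s := by
    intro s hs
    obtain ⟨x, -, rfl⟩ := hcomp s hs
    exact hFopen.connectedComponentIn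
  have heq : ∀ s ∈ T, ∀ y ∈ s, s = connectedComponentIn F y := by
    intro s hs y hy
    obtain ⟨x, -, rfl⟩ := hcomp s hs
    exact connectedComponentIn_eq hy
  have hcard := card_regions_le T (fun s => φ ⁻¹' s) g D (hgdeg.trans hfD)
    (fun s hs => (hsopen s hs).preimage hφ) ?_ ?_ ?_ ?_
  · rw [Set.encard_coe_eq_coe_finsetCard] at hT
    have hT' : T.card = 4 * D ^ 2 + 1 := by exact_mod_cast hT
    nlinarith
  · intro s hs
    obtain ⟨x, hxs, hxh⟩ := (hTS hs).2
    obtain ⟨t, rfl⟩ := hφh x hxh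
    exact ⟨t, hxs⟩
  · intro s hs r hr hsr
    refine Set.disjoint_left.2 fun t hts htr => hsr ?_
    rw [heq s hs _ hts, ← heq r hr _ htr]
  · intro s hs t ht
    obtain ⟨x, -, rfl⟩ := hcomp s hs
    rw [hg]
    exact connectedComponentIn_subset F x ht
  · intro s hs t ht
    by_contra hne
    rw [hg] at hne
    have htF : φ t ∈ F := hne
    rw [((hsopen s hs).preimage hφ).frontier_eq] at ht
    obtain ⟨t', ht', hs'⟩ := mem_closure_iff.1 ht.1 (φ ⁻¹' connectedComponentIn F (φ t))
      (hFopen.connectedComponentIn.preimage hφ) (mem_connectedComponentIn htF)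
    refine ht.2 ?_
    change φ t ∈ s
    rw [heq s hs _ hs', ← connectedComponentIn_eq ht']
    exact mem_connectedComponentIn htF
end
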